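/- arXiv:1508.06591 — 2 statements merged into one kernel-verified Lean document; each statement's English description precedes it below -/
import Mathlib

section
/- Let d ≥ 1 be a real number. For ξ ≤ 0 define x_n = (1/d)^{1/(2d)} (1 + ξ/(d n log 4)). Then lim_{n→∞} ∏_{j=0}^{n−1} ( 1 − (∫_{n x_n^{2d}}^{n/d} t^{(j+1)/d − 1} e^{−t} dt) / γ((j+1)/d, n/d) ) = e^{ξ}, and the convergence is uniform for ξ in compact subsets of (−∞, 0]. (This product equals the probability P_n[n d (d^{1/(2d)} |z|_n − 1) log 4 ≤ ξ] that the rescaled spectral radius of the hard edge ensemble with potential Q(z) = |z|^{2d} is at most ξ.) -/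
open MeasureTheory Filter Finset

/-- The lower incomplete gamma function `γ(a,x) = ∫_0^x t^(a-1) e^(-t) dt`. -/
noncomputable def lowerGamma (a x : ℝ) : ℝ :=
  ∫ t in (0 : ℝ)..x, t ^ (a - 1) * Real.exp (-t)

/-- The integrand of the lower incomplete gamma function `γ((m ^ 2 - κ) / d, m ^ 2 / d)`, normalized
at the endpoint `m ^ 2 / d` and seen from it at the scale `m`. -/
noncomputable def hardEdgeKernel (d m κ w : ℝ) : ℝ :=
  (1 - d * w / m) ^ ((m ^ 2 - κ) / d - 1) * Real.exp (w * m)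

theorem log_one_sub_le_quadratic {x : ℝ} (h0 : 0 ≤ x) (h1 : x < 1) :
    Real.log (1 - x) ≤ -x - x ^ 2 / 2 := by
  have h := Real.hasSum_pow_div_log_of_abs_lt_one (x := x) (by rwa [abs_of_nonneg h0])
  have := sum_le_hasSum (Finset.range 2) (fun i _ => by positivity) h
  norm_num [Finset.sum_range_succ] at this
  linarith

theorem neg_sub_two_mul_sq_le_log_one_sub {x : ℝ} (h1 : x ≤ 1 / 2) :
    -x - 2 * x ^ 2 ≤ Real.log (1 - x) := by
  have h := Real.one_sub_inv_le_log_of_pos (x := 1 - x) (by linarith)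
  have : (1 - x)⁻¹ ≤ 1 + x + 2 * x ^ 2 := by
    rw [inv_le_iff_one_le_mul₀ (by linarith)]
    nlinarith [mul_nonneg (sq_nonneg x) (by linarith : 0 ≤ 1 - 2 * x)]
  linarith

theorem hardEdgeKernel_eq_exp {d m κ w : ℝ} (h : d * w / m < 1) :
    hardEdgeKernel d m κ w =
      Real.exp (Real.log (1 - d * w / m) * ((m ^ 2 - κ) / d - 1) + w * m) := by
  rw [hardEdgeKernel, Real.rpow_def_of_pos (by linarith), Real.exp_add]

theorem hardEdgeKernel_nonneg {d m κ w : ℝ} (h : d * w / m ≤ 1) : 0 ≤ hardEdgeKernel d m κ w :=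
  mul_nonneg (Real.rpow_nonneg (by linarith) _) (Real.exp_pos _).le

theorem exp_le_hardEdgeKernel {d m κ w : ℝ} (hd : 0 < d) (hm : 0 < m) (hκ : 0 ≤ κ)
    (hκm : κ ≤ m ^ 2) (hw : 0 ≤ w) (h : d * w / m ≤ 1 / 2) :
    Real.exp (κ * w / m - 2 * d * w ^ 2) ≤ hardEdgeKernel d m κ w := by
  have hx0 : 0 ≤ d * w / m := by positivity
  rw [hardEdgeKernel_eq_exp (by linarith), Real.exp_le_exp]
  have hl := neg_sub_two_mul_sq_le_log_one_sub h
  have hneg : Real.log (1 - d * w / m) ≤ 0 := Real.log_nonpos (by linarith) (by linarith)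
  have ha : 0 ≤ (m ^ 2 - κ) / d := div_nonneg (by linarith) hd.le
  have h1 := mul_le_mul_of_nonneg_right hl ha
  have h2 : (-(d * w / m) - 2 * (d * w / m) ^ 2) * ((m ^ 2 - κ) / d) =
      κ * w / m - w * m - 2 * d * w ^ 2 + 2 * (d * w / m) ^ 2 * (κ / d) := by
    field_simp
    ring
  have h3 : 0 ≤ 2 * (d * w / m) ^ 2 * (κ / d) := by positivity
  linarith

theorem hardEdgeKernel_le_exp {d m κ w : ℝ} (hd : 0 < d) (hm : 0 < m)
    (hκm : κ ≤ m ^ 2) (hw : 0 ≤ w) (h : d * w / m ≤ 1 / 2) :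
    hardEdgeKernel d m κ w ≤ (1 + 2 * (d * w / m)) * Real.exp (κ * w / m) := by
  set x := d * w / m with hx
  have hx0 : 0 ≤ x := by positivity
  have ha : 0 ≤ (m ^ 2 - κ) / d := div_nonneg (by linarith) hd.le
  rw [hardEdgeKernel, ← hx, Real.rpow_sub_one (by linarith), div_mul_eq_mul_div,
    div_le_iff₀ (by linarith), Real.rpow_def_of_pos (by linarith), ← Real.exp_add]
  have h1 : Real.log (1 - x) ≤ -x := by
    have := Real.log_le_sub_one_of_pos (x := 1 - x) (by linarith)
    linarith
  have h2 := mul_le_mul_of_nonneg_right h1 ha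
  have h3 : -x * ((m ^ 2 - κ) / d) = κ * w / m - w * m := by
    rw [hx]; field_simp; ring
  have h4 : Real.exp (Real.log (1 - x) * ((m ^ 2 - κ) / d) + w * m) ≤ Real.exp (κ * w / m) := by
    rw [Real.exp_le_exp]; linarith
  have h5 : 1 ≤ (1 + 2 * x) * (1 - x) := by nlinarith
  nlinarith [Real.exp_pos (κ * w / m)]

theorem hardEdgeKernel_le_exp_quadratic {d m κ w s : ℝ} (hd : 0 < d) (hm : 1 ≤ m)
    (hκs : κ ≤ s * m) (hκm : κ + d ≤ m ^ 2 / 2) (hw : 0 ≤ w) (h : d * w / m < 1) :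
    hardEdgeKernel d m κ w ≤ Real.exp ((s + d) * w - d / 4 * w ^ 2) := by
  have hm0 : 0 < m := by linarith
  have hx0 : 0 ≤ d * w / m := by positivity
  rw [hardEdgeKernel_eq_exp h, Real.exp_le_exp]
  have hl := log_one_sub_le_quadratic hx0 h
  have ha : m ^ 2 / (2 * d) ≤ (m ^ 2 - κ) / d - 1 := by
    rw [div_sub_one hd.ne', div_le_div_iff₀ (by positivity) hd]
    nlinarith
  have h1 := mul_le_mul_of_nonneg_right hl (le_trans (by positivity) ha)
  have h2 : (-(d * w / m)) * ((m ^ 2 - κ) / d - 1) = (κ + d) / m * w - w * m := by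
    field_simp; ring
  have h3 : (d * w / m) ^ 2 / 2 * (m ^ 2 / (2 * d)) = d / 4 * w ^ 2 := by
    field_simp; ring
  have h4 := mul_le_mul_of_nonneg_left ha (by positivity : 0 ≤ (d * w / m) ^ 2 / 2)
  have h5 : (κ + d) / m ≤ s + d := by
    rw [div_le_iff₀ hm0]; nlinarith
  nlinarith [mul_le_mul_of_nonneg_right h5 hw]

theorem tendsto_log_one_sub_add_div_sq :
    Tendsto (fun x : ℝ => (Real.log (1 - x) + x) / x ^ 2) (nhdsWithin 0 {0}ᶜ)
      (nhds (-(1 / 2))) := by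
  have hb : Tendsto (fun x : ℝ => |x| / (1 - |x|)) (nhdsWithin 0 {0}ᶜ) (nhds 0) := by
    have : ContinuousAt (fun x : ℝ => |x| / (1 - |x|)) 0 :=
      ContinuousAt.div (by fun_prop) (by fun_prop) (by simp)
    simpa using this.tendsto.mono_left nhdsWithin_le_nhds
  rw [tendsto_iff_norm_sub_tendsto_zero]
  refine squeeze_zero' (Eventually.of_forall fun _ => norm_nonneg _) ?_ hb
  have hsmall : ∀ᶠ x : ℝ in nhdsWithin 0 {0}ᶜ, |x| < 1 := by
    have : ContinuousAt (fun x : ℝ => |x|) 0 := by fun_prop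
    exact (this.tendsto.mono_left nhdsWithin_le_nhds).eventually_lt_const (by simp)
  filter_upwards [hsmall, self_mem_nhdsWithin] with x hx hx0
  have hx0 : x ≠ 0 := hx0
  have h := Real.abs_log_sub_add_sum_range_le hx 2
  have e : (Real.log (1 - x) + x) / x ^ 2 - -(1 / 2) =
      (∑ i ∈ Finset.range 2, x ^ (i + 1) / ((i : ℝ) + 1) + Real.log (1 - x)) / x ^ 2 := by
    simp only [Finset.sum_range_succ, Finset.sum_range_zero]
    field_simp
    push_cast
    ring
  rw [e, Real.norm_eq_abs, abs_div, abs_of_nonneg (sq_nonneg x), div_le_iff₀ (by positivity)]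
  refine h.trans (le_of_eq ?_)
  rw [← sq_abs x]
  ring

theorem tendsto_hardEdgeKernel {ι : Type*} {l : Filter ι} {d s w : ℝ} {m κ : ι → ℝ} (hd : 0 < d)
    (hm : Tendsto m l atTop) (hκ : Tendsto (fun i => κ i / m i) l (nhds s)) (hw : 0 < w) :
    Tendsto (fun i => hardEdgeKernel d (m i) (κ i) w) l
      (nhds (Real.exp (s * w - d / 2 * w ^ 2))) := by
  have hx : Tendsto (fun i => d * w / m i) l (nhds 0) := hm.const_div_atTop _
  have hinv : Tendsto (fun i => (m i)⁻¹) l (nhds 0) := tendsto_inv_atTop_zero.comp hm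
  have hx' : Tendsto (fun i => d * w / m i) l (nhdsWithin 0 {0}ᶜ) := by
    refine tendsto_nhdsWithin_iff.2 ⟨hx, ?_⟩
    filter_upwards [hm.eventually_gt_atTop 0] with i hi
    have : d * w / m i ≠ 0 := by positivity
    simpa using this
  have hq := tendsto_log_one_sub_add_div_sq.comp hx'
  have main : Tendsto (fun i => (Real.log (1 - d * w / m i) + d * w / m i) / (d * w / m i) ^ 2 *
        (d * w ^ 2) * (1 - κ i / m i * (m i)⁻¹ - d * (m i)⁻¹ * (m i)⁻¹)
        + (κ i / m i + d * (m i)⁻¹) * w) l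
      (nhds (-(1 / 2) * (d * w ^ 2) * (1 - s * 0 - d * 0 * 0) + (s + d * 0) * w)) :=
    ((hq.mul_const _).mul (((hκ.mul hinv).const_sub 1).sub ((hinv.const_mul d).mul hinv))).add
      ((hκ.add (hinv.const_mul d)).mul_const w)
  have e : -(1 / 2) * (d * w ^ 2) * (1 - s * 0 - d * 0 * 0) + (s + d * 0) * w =
      s * w - d / 2 * w ^ 2 := by ring
  rw [e] at main
  refine ((Real.continuous_exp.tendsto _).comp main).congr' ?_
  filter_upwards [hm.eventually_gt_atTop 0, hx.eventually_lt_const one_pos] with i hi hi1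
  rw [hardEdgeKernel_eq_exp hi1, Function.comp_apply]
  congr 1
  field_simp
  ring

theorem intervalIntegrable_hardEdgeKernel {d m κ : ℝ} (hd : 0 < d) (hm : 0 < m) (hκm : κ < m ^ 2)
    (z : ℝ) : IntervalIntegrable (hardEdgeKernel d m κ) volume 0 z := by
  have ha : -1 < (m ^ 2 - κ) / d - 1 := by
    have : 0 < (m ^ 2 - κ) / d := div_pos (by linarith) hd
    linarith
  have hc : d / m ≠ 0 := (div_pos hd hm).ne'
  have h := ((intervalIntegral.intervalIntegrable_rpow' ha (a := 1)
    (b := 1 - d / m * z)).comp_sub_left 1).comp_mul_left (c := d / m)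
  have e : (1 - (1 - d / m * z)) / (d / m) = z := by field_simp; ring
  rw [e, sub_self, zero_div] at h
  refine (h.mul_continuousOn (g := fun w => Real.exp (w * m)) (by fun_prop)).congr ?_
  intro w _
  simp only [hardEdgeKernel]
  rw [div_mul_eq_mul_div]

/-- The total mass of `hardEdgeKernel`, a normalization of the lower incomplete gamma function. -/
noncomputable def hardEdgeMass (d m κ : ℝ) : ℝ :=
  ∫ w in (0 : ℝ)..(m / d), hardEdgeKernel d m κ w

theorem integral_rpow_mul_exp_neg_eq {d m κ z : ℝ} (hd : 0 < d) (hm : 0 < m) (hz0 : 0 ≤ z)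
    (hz : z ≤ m / d) :
    ∫ t in (m ^ 2 / d - m * z)..(m ^ 2 / d), t ^ ((m ^ 2 - κ) / d - 1) * Real.exp (-t) =
      m * ((m ^ 2 / d) ^ ((m ^ 2 - κ) / d - 1) * Real.exp (-(m ^ 2 / d))) *
        ∫ w in (0 : ℝ)..z, hardEdgeKernel d m κ w := by
  have h := intervalIntegral.integral_comp_sub_mul (a := 0) (b := z)
    (fun t : ℝ => t ^ ((m ^ 2 - κ) / d - 1) * Real.exp (-t)) hm.ne' (m ^ 2 / d)
  rw [mul_zero, sub_zero, smul_eq_mul, eq_inv_mul_iff_mul_eq₀ hm.ne'] at h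
  rw [← h, mul_assoc]
  congr 1
  rw [← intervalIntegral.integral_const_mul]
  refine intervalIntegral.integral_congr fun w hw => ?_
  rw [Set.uIcc_of_le hz0] at hw
  have hx : d * w / m ≤ 1 := by
    rw [div_le_one hm]
    have := (le_div_iff₀ hd).1 (hw.2.trans hz)
    linarith
  have e : m ^ 2 / d - m * w = m ^ 2 / d * (1 - d * w / m) := by field_simp
  have e2 : -(m ^ 2 / d - m * w) = -(m ^ 2 / d) + w * m := by ring
  simp only [hardEdgeKernel]
  rw [e2, Real.exp_add, e, Real.mul_rpow (by positivity) (by linarith)]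
  ring

theorem integral_div_lowerGamma_eq {d m κ z : ℝ} (hd : 0 < d) (hm : 0 < m) (hz0 : 0 ≤ z)
    (hz : z ≤ m / d) :
    (∫ t in (m ^ 2 / d - m * z)..(m ^ 2 / d), t ^ ((m ^ 2 - κ) / d - 1) * Real.exp (-t)) /
      lowerGamma ((m ^ 2 - κ) / d) (m ^ 2 / d) =
      (∫ w in (0 : ℝ)..z, hardEdgeKernel d m κ w) / hardEdgeMass d m κ := by
  have h0 := integral_rpow_mul_exp_neg_eq (κ := κ) hd hm (by positivity) (le_refl (m / d))
  have e : m ^ 2 / d - m * (m / d) = 0 := by ring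
  rw [e] at h0
  rw [lowerGamma, h0, integral_rpow_mul_exp_neg_eq hd hm hz0 hz, hardEdgeMass,
    mul_div_mul_left _ _ (by positivity)]

theorem mul_exp_le_integral_hardEdgeKernel {d m κ z : ℝ} (hd : 0 < d) (hm : 0 < m) (hκ : 0 ≤ κ)
    (hκm : κ < m ^ 2) (hz0 : 0 ≤ z) (hz : d * z / m ≤ 1 / 2) :
    z * Real.exp (-(2 * d * z ^ 2)) ≤ ∫ w in (0 : ℝ)..z, hardEdgeKernel d m κ w := by
  have h := intervalIntegral.integral_mono_on hz0
    (intervalIntegrable_const (c := Real.exp (-(2 * d * z ^ 2))) (μ := volume))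
    (intervalIntegrable_hardEdgeKernel hd hm hκm z) ?_
  · simpa using h
  intro w hw
  have hw0 := hw.1
  have hx : d * w / m ≤ d * z / m := by gcongr; exact hw.2
  refine le_trans ?_ (exp_le_hardEdgeKernel hd hm hκ hκm.le hw.1 (hx.trans hz))
  rw [Real.exp_le_exp]
  have h1 : 0 ≤ κ * w / m := by positivity
  have h2 : w ^ 2 ≤ z ^ 2 := by gcongr; exact hw.2
  nlinarith

theorem integral_hardEdgeKernel_le {d m κ z : ℝ} (hd : 0 < d) (hm : 0 < m) (hκ : 0 ≤ κ)
    (hκm : κ < m ^ 2) (hz0 : 0 ≤ z) (hz : d * z / m ≤ 1 / 2) :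
    ∫ w in (0 : ℝ)..z, hardEdgeKernel d m κ w ≤
      z * ((1 + 2 * (d * z / m)) * Real.exp (κ * z / m)) := by
  have h := intervalIntegral.integral_mono_on hz0
    (intervalIntegrable_hardEdgeKernel hd hm hκm z)
    (intervalIntegrable_const (c := (1 + 2 * (d * z / m)) * Real.exp (κ * z / m)) (μ := volume)) ?_
  · rwa [intervalIntegral.integral_const, sub_zero, smul_eq_mul] at h
  intro w hw
  have hw0 := hw.1
  have hwz := hw.2
  have hx : d * w / m ≤ d * z / m := by gcongr
  refine (hardEdgeKernel_le_exp hd hm hκm.le hw.1 (hx.trans hz)).trans ?_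
  gcongr

theorem exp_le_hardEdgeMass {d m κ : ℝ} (hd : 0 < d) (hm : 4 * d ≤ m) (hκ : 0 ≤ κ)
    (hκm : κ < m ^ 2) : Real.exp (κ / m - 8 * d) ≤ hardEdgeMass d m κ := by
  have hm0 : 0 < m := by linarith
  have h4 : 4 ≤ m / d := by rwa [le_div_iff₀ hd]
  have hI := intervalIntegrable_hardEdgeKernel hd hm0 hκm
  have h1 : ∫ w in (1 : ℝ)..2, hardEdgeKernel d m κ w ≤ hardEdgeMass d m κ := by
    refine intervalIntegral.integral_mono_interval (by norm_num) (by norm_num) (by linarith) ?_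
      (hI _)
    refine (ae_restrict_iff' measurableSet_Ioc).2 (Eventually.of_forall fun w hw => ?_)
    refine hardEdgeKernel_nonneg ?_
    rw [div_le_one hm0]
    have := (le_div_iff₀ hd).1 hw.2
    linarith
  refine le_trans ?_ h1
  have h := intervalIntegral.integral_mono_on (a := 1) (b := 2) (by norm_num)
    (intervalIntegrable_const (c := Real.exp (κ / m - 8 * d)) (μ := volume))
    ((hI 1).symm.trans (hI 2)) ?_
  · norm_num at h
    exact h
  intro w hw
  have hx : d * w / m ≤ 1 / 2 := by
    rw [div_le_iff₀ hm0]
    nlinarith [hw.2]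
  refine le_trans ?_ (exp_le_hardEdgeKernel hd hm0 hκ hκm.le (by linarith [hw.1]) hx)
  rw [Real.exp_le_exp]
  have h1 : κ / m ≤ κ * w / m := by
    gcongr
    nlinarith [hw.1]
  have h2 : w ^ 2 ≤ 4 := by nlinarith [hw.1, hw.2]
  nlinarith

theorem hardEdgeMass_pos {d m κ : ℝ} (hd : 0 < d) (hm : 4 * d ≤ m) (hκ : 0 ≤ κ)
    (hκm : κ < m ^ 2) : 0 < hardEdgeMass d m κ :=
  (Real.exp_pos _).trans_le (exp_le_hardEdgeMass hd hm hκ hκm)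

theorem integrable_exp_sub_mul_sq (c : ℝ) {b : ℝ} (hb : 0 < b) :
    Integrable fun w : ℝ => Real.exp (c * w - b * w ^ 2) := by
  have h := ((integrable_exp_neg_mul_sq hb).comp_sub_right (c / (2 * b))).const_mul
    (Real.exp (c ^ 2 / (4 * b)))
  refine h.congr (Eventually.of_forall fun w => ?_)
  simp only
  rw [← Real.exp_add]
  congr 1
  field_simp
  ring

/-- The limit of `hardEdgeMass` when `κ / m → s` and `m → ∞`. -/
noncomputable def gaussianMass (d s : ℝ) : ℝ :=
  ∫ w in Set.Ioi (0 : ℝ), Real.exp (s * w - d / 2 * w ^ 2)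

theorem tendsto_hardEdgeMass {ι : Type*} {l : Filter ι} [l.IsCountablyGenerated] {d s : ℝ}
    {m κ : ι → ℝ} (hd : 0 < d)
    (hm : Tendsto m l atTop) (hκ : Tendsto (fun i => κ i / m i) l (nhds s)) :
    Tendsto (fun i => hardEdgeMass d (m i) (κ i)) l (nhds (gaussianMass d s)) := by
  have hev : ∀ᶠ i in l, hardEdgeMass d (m i) (κ i) = ∫ w in Set.Ioi (0 : ℝ),
      (Set.Iio (m i / d)).indicator (hardEdgeKernel d (m i) (κ i)) w := by
    filter_upwards [hm.eventually_gt_atTop 0] with i hi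
    rw [hardEdgeMass, intervalIntegral.integral_of_le (by positivity),
      integral_Ioc_eq_integral_Ioo, setIntegral_indicator measurableSet_Iio]
    rfl
  rw [tendsto_congr' hev, gaussianMass]
  refine tendsto_integral_filter_of_dominated_convergence
    (fun w => Real.exp ((s + 1 + d) * w - d / 4 * w ^ 2)) ?_ ?_
    (integrable_exp_sub_mul_sq _ (by positivity)).integrableOn ?_
  · refine Eventually.of_forall fun i =>
      (Measurable.indicator ?_ measurableSet_Iio).aestronglyMeasurable
    unfold hardEdgeKernel
    fun_prop
  · have hκ' := hκ.eventually_lt_const (by linarith : s < s + 1)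
    filter_upwards [hκ', hm.eventually_ge_atTop 1, hm.eventually_ge_atTop (2 * (|s| + 1 + d))]
      with i h1 h2 h3
    have hm0 : 0 < m i := by linarith
    have hκs : κ i ≤ (s + 1) * m i := ((div_lt_iff₀ hm0).1 h1).le
    refine (ae_restrict_iff' measurableSet_Ioi).2 (Eventually.of_forall fun w hw => ?_)
    have hw : 0 < w := hw
    by_cases hwm : w < m i / d
    · have hx : d * w / m i < 1 := by
        rw [div_lt_one hm0]
        have := (lt_div_iff₀ hd).1 hwm
        linarith
      rw [Set.indicator_of_mem (by exact hwm), Real.norm_of_nonneg (hardEdgeKernel_nonneg hx.le)]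
      refine hardEdgeKernel_le_exp_quadratic hd h2 hκs ?_ hw.le hx
      have := le_abs_self s
      nlinarith
    · rw [Set.indicator_of_notMem (by exact hwm), norm_zero]
      positivity
  · refine (ae_restrict_iff' measurableSet_Ioi).2 (Eventually.of_forall fun w hw => ?_)
    refine (tendsto_hardEdgeKernel hd hm hκ hw).congr' ?_
    filter_upwards [hm.eventually_gt_atTop (w * d)] with i hi
    rw [Set.indicator_of_mem]
    exact (lt_div_iff₀ hd).2 hi

theorem gaussianMass_eq {d : ℝ} (hd : 0 < d) (s : ℝ) :
    gaussianMass d s = Real.exp (s ^ 2 / (2 * d)) *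
      ((∫ u in Set.Ioi (0 : ℝ), Real.exp (-(d / 2) * u ^ 2)) +
        ∫ u in (0 : ℝ)..(s / d), Real.exp (-(d / 2) * u ^ 2)) := by
  set g : ℝ → ℝ := fun u => Real.exp (-(d / 2) * u ^ 2) with hg
  have hgc : Continuous g := by fun_prop
  have h1 := intervalIntegral_tendsto_integral_Ioi 0
    (integrable_exp_sub_mul_sq s (by positivity : 0 < d / 2)).integrableOn
    (tendsto_id (α := ℝ) (x := atTop))
  have h2 := intervalIntegral_tendsto_integral_Ioi 0
    (integrable_exp_neg_mul_sq (by positivity : 0 < d / 2)).integrableOn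
    (tendsto_atTop_add_const_right atTop (-(s / d)) (tendsto_id (α := ℝ)))
  refine tendsto_nhds_unique h1 (((h2.add_const (∫ u in (0 : ℝ)..(s / d), g u)).const_mul
    (Real.exp (s ^ 2 / (2 * d)))).congr fun R => ?_)
  have e1 : ∀ w : ℝ, Real.exp (s * w - d / 2 * w ^ 2) =
      Real.exp (s ^ 2 / (2 * d)) * g (w - s / d) := by
    intro w
    rw [hg, ← Real.exp_add]
    congr 1
    field_simp
    ring
  have e2 : ∫ u in (0 : ℝ)..(s / d), g u = ∫ u in (-(s / d))..0, g u := by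
    have := intervalIntegral.integral_comp_neg (a := 0) (b := s / d) g
    rw [neg_zero] at this
    rw [← this]
    refine intervalIntegral.integral_congr fun w _ => ?_
    simp [hg]
  simp only [id, e1]
  rw [intervalIntegral.integral_const_mul, intervalIntegral.integral_comp_sub_right, zero_sub, e2,
    add_comm, intervalIntegral.integral_add_adjacent_intervals (hgc.intervalIntegrable _ _)
      (hgc.intervalIntegrable _ _), sub_eq_add_neg]

theorem gaussianMass_pos {d s : ℝ} (hd : 0 < d) (hs : 0 ≤ s) : 0 < gaussianMass d s := by
  rw [gaussianMass_eq hd, integral_gaussian_Ioi]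
  have : 0 ≤ ∫ u in (0 : ℝ)..(s / d), Real.exp (-(d / 2) * u ^ 2) :=
    intervalIntegral.integral_nonneg (by positivity) fun _ _ => (Real.exp_pos _).le
  positivity

theorem integral_inv_gaussianMass {d : ℝ} (hd : 0 < d) :
    ∫ s in Set.Ioi (0 : ℝ), (gaussianMass d s)⁻¹ = d * Real.log 2 := by
  set g : ℝ → ℝ := fun u => Real.exp (-(d / 2) * u ^ 2) with hg
  have hgc : Continuous g := by fun_prop
  set C : ℝ := ∫ u in Set.Ioi (0 : ℝ), g u with hC
  have hCpos : 0 < C := by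
    rw [hC, hg, integral_gaussian_Ioi]
    positivity
  set E : ℝ → ℝ := fun s => C + ∫ u in (0 : ℝ)..(s / d), g u with hE
  have hEpos : ∀ s, 0 ≤ s → 0 < E s := fun s hs => by
    have : 0 ≤ ∫ u in (0 : ℝ)..(s / d), g u :=
      intervalIntegral.integral_nonneg (by positivity) fun _ _ => (Real.exp_pos _).le
    exact add_pos_of_pos_of_nonneg hCpos this
  have hderiv : ∀ s, HasDerivAt E (g (s / d) * (1 / d)) s := fun s => by
    have h : HasDerivAt (fun x => ∫ u in (0 : ℝ)..x, g u) (g (s / d)) (s / d) :=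
      (hgc.integral_hasStrictDerivAt 0 (s / d)).hasDerivAt
    exact (h.comp s ((hasDerivAt_id s).div_const d)).const_add C
  have hlog : ∀ s, 0 ≤ s → HasDerivAt (fun s => d * Real.log (E s)) (gaussianMass d s)⁻¹ s := by
    intro s hs
    have h := ((hderiv s).log (hEpos s hs).ne').const_mul d
    have e : d * (g (s / d) * (1 / d) / E s) = (gaussianMass d s)⁻¹ := by
      have e1 : g (s / d) = (Real.exp (s ^ 2 / (2 * d)))⁻¹ := by
        rw [hg, ← Real.exp_neg]
        field_simp
      have e2 : gaussianMass d s = Real.exp (s ^ 2 / (2 * d)) * E s := gaussianMass_eq hd s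
      rw [e2, mul_inv, e1]
      field_simp
    rwa [e] at h
  have hlim : Tendsto (fun s => d * Real.log (E s)) atTop (nhds (d * Real.log (C + C))) := by
    have h2 := intervalIntegral_tendsto_integral_Ioi 0
      (integrable_exp_neg_mul_sq (by positivity : 0 < d / 2)).integrableOn
      (tendsto_id.atTop_div_const hd : Tendsto (fun s : ℝ => id s / d) atTop atTop)
    exact ((h2.const_add C).log (by positivity)).const_mul d
  rw [integral_Ioi_of_hasDerivAt_of_nonneg (hlog 0 le_rfl).continuousAt.continuousWithinAt
    (fun s hs => hlog s (le_of_lt hs))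
    (fun s hs => (inv_pos.2 (gaussianMass_pos hd (le_of_lt hs))).le) hlim]
  have e0 : E 0 = C := by simp [hE]
  rw [e0, ← two_mul, Real.log_mul two_ne_zero hCpos.ne']
  ring

theorem sum_range_eq_integral_floor (f : ℕ → ℝ) (n : ℕ) :
    ∑ k ∈ Finset.range n, f k = ∫ t in (0 : ℝ)..n, f ⌊t⌋₊ := by
  have hE : ∀ k : ℕ, Set.EqOn (fun _ : ℝ => f k) (fun t : ℝ => f ⌊t⌋₊)
      (Set.Ioo (k : ℝ) ((k + 1 : ℕ) : ℝ)) := by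
    intro k t ht
    have : ⌊t⌋₊ = k := by
      rw [Nat.floor_eq_iff ((Nat.cast_nonneg k).trans ht.1.le)]
      exact ⟨ht.1.le, by simpa using ht.2⟩
    simp [this]
  have hle : ∀ k : ℕ, (k : ℝ) ≤ ((k + 1 : ℕ) : ℝ) := fun k => by simp
  have h := intervalIntegral.sum_integral_adjacent_intervals (f := fun t : ℝ => f ⌊t⌋₊)
    (μ := volume) (a := fun k : ℕ => (k : ℝ)) (n := n) fun k _ =>
      (intervalIntegrable_const (c := f k)).congr_uIoo (by
        rw [Set.uIoo_of_le (hle k)]; exact hE k)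
  rw [Nat.cast_zero] at h
  rw [← h]
  refine Finset.sum_congr rfl fun k _ => ?_
  rw [← intervalIntegral.integral_congr_Ioo_of_le (hle k) (hE k)]
  simp

theorem tendsto_sum_exp_div_hardEdgeMass {d Y : ℝ} (hd : 0 < d) (hY : 0 ≤ Y) :
    Tendsto (fun n : ℕ => ∑ k ∈ Finset.range n,
      Real.exp (Y * (k / n)) / (√n * hardEdgeMass d √n k)) atTop (nhds (d * Real.log 2)) := by
  have hm : Tendsto (fun n : ℕ => √(n : ℝ)) atTop atTop :=
    Real.tendsto_sqrt_atTop.comp tendsto_natCast_atTop_atTop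
  have hev : ∀ᶠ n : ℕ in atTop, ∑ k ∈ Finset.range n,
      Real.exp (Y * (k / n)) / (√n * hardEdgeMass d √n k) =
      ∫ s in Set.Ioi (0 : ℝ), (Set.Iio √(n : ℝ)).indicator (fun s =>
        Real.exp (Y * (⌊s * √(n : ℝ)⌋₊ / n)) / hardEdgeMass d √n ⌊s * √(n : ℝ)⌋₊) s := by
    filter_upwards [eventually_gt_atTop 0] with n hn
    have hm0 : 0 < √(n : ℝ) := by positivity
    have h := intervalIntegral.integral_comp_mul_right (a := 0) (b := √(n : ℝ))
      (fun t : ℝ => Real.exp (Y * (⌊t⌋₊ / n)) / (√n * hardEdgeMass d √n ⌊t⌋₊)) hm0.ne'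
    rw [zero_mul, Real.mul_self_sqrt (Nat.cast_nonneg n), smul_eq_mul,
      eq_inv_mul_iff_mul_eq₀ hm0.ne'] at h
    rw [sum_range_eq_integral_floor (fun k => Real.exp (Y * (k / n)) /
      (√n * hardEdgeMass d √n k)), ← h, ← intervalIntegral.integral_const_mul,
      intervalIntegral.integral_of_le hm0.le, integral_Ioc_eq_integral_Ioo,
      setIntegral_indicator measurableSet_Iio]
    change _ = ∫ s in Set.Ioo 0 √(n : ℝ), _
    congr 1
    ext s
    rw [← mul_div_assoc, mul_div_mul_left _ _ hm0.ne']
  rw [tendsto_congr' hev, ← integral_inv_gaussianMass hd]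
  refine tendsto_integral_filter_of_dominated_convergence
    (fun s => Real.exp (Y + 8 * d + 1) * Real.exp (-s)) ?_ ?_
    ((integrableOn_exp_neg_Ioi 0).const_mul _) ?_
  · refine Eventually.of_forall fun n =>
      (Measurable.indicator ?_ measurableSet_Iio).aestronglyMeasurable
    exact (measurable_from_nat (f := fun k : ℕ => Real.exp (Y * (k / n)) /
      hardEdgeMass d √n k)).comp (Nat.measurable_floor.comp (measurable_id.mul_const _))
  · filter_upwards [hm.eventually_ge_atTop (4 * d), hm.eventually_ge_atTop 1] with n hn hn1
    have hm0 : 0 < √(n : ℝ) := by linarith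
    have hsq : √(n : ℝ) ^ 2 = n := Real.sq_sqrt (Nat.cast_nonneg n)
    refine (ae_restrict_iff' measurableSet_Ioi).2 (Eventually.of_forall fun s hs => ?_)
    have hs : 0 < s := hs
    by_cases hsm : s < √(n : ℝ)
    · rw [Set.indicator_of_mem (by exact hsm)]
      have hk1 : (⌊s * √(n : ℝ)⌋₊ : ℝ) ≤ s * √(n : ℝ) := Nat.floor_le (by positivity)
      have hk2 : s * √(n : ℝ) < ⌊s * √(n : ℝ)⌋₊ + 1 := Nat.lt_floor_add_one _
      set k : ℝ := (⌊s * √(n : ℝ)⌋₊ : ℝ)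
      have hkn : k < √(n : ℝ) ^ 2 := by nlinarith
      have hk0 : 0 ≤ k := Nat.cast_nonneg _
      have hmass := exp_le_hardEdgeMass hd hn hk0 hkn
      have hpos := hardEdgeMass_pos hd hn hk0 hkn
      rw [Real.norm_of_nonneg (by positivity), div_le_iff₀ hpos]
      have hks : s - 1 ≤ k / √(n : ℝ) := by
        rw [le_div_iff₀ hm0]
        nlinarith
      have hkn' : k / n ≤ 1 := by
        rw [hsq] at hkn
        exact div_le_one_of_le₀ hkn.le (Nat.cast_nonneg n)
      calc Real.exp (Y * (k / n)) ≤ Real.exp (Y + 8 * d + 1 + -s + (k / √(n : ℝ) - 8 * d)) := by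
            rw [Real.exp_le_exp]
            nlinarith
        _ = Real.exp (Y + 8 * d + 1) * Real.exp (-s) * Real.exp (k / √(n : ℝ) - 8 * d) := by
            rw [Real.exp_add, Real.exp_add (Y + 8 * d + 1)]
        _ ≤ _ := by gcongr
    · rw [Set.indicator_of_notMem (by exact hsm), norm_zero]
      positivity
  · refine (ae_restrict_iff' measurableSet_Ioi).2 (Eventually.of_forall fun s hs => ?_)
    have hs : 0 < s := hs
    have hκ : Tendsto (fun n : ℕ => (⌊s * √(n : ℝ)⌋₊ : ℝ) / √(n : ℝ)) atTop (nhds s) :=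
      (tendsto_nat_floor_mul_div_atTop hs.le).comp hm
    have hκ' : Tendsto (fun n : ℕ => (⌊s * √(n : ℝ)⌋₊ : ℝ) / n) atTop (nhds 0) := by
      refine (hκ.div_atTop hm).congr fun n => ?_
      rw [div_div, Real.mul_self_sqrt (Nat.cast_nonneg n)]
    have h := ((Real.continuous_exp.tendsto _).comp (hκ'.const_mul Y)).div
      (tendsto_hardEdgeMass hd hm hκ) (gaussianMass_pos hd hs.le).ne'
    rw [mul_zero, Real.exp_zero, one_div] at h
    refine h.congr' ?_
    filter_upwards [hm.eventually_gt_atTop s] with n hn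
    rw [Set.indicator_of_mem (by exact hn)]
    rfl

theorem one_sub_div_rpow_le {p v : ℝ} (hp : 1 ≤ p) (hv0 : 0 ≤ v) (hv1 : v ≤ 1) :
    (1 - v / p) ^ p ≤ 1 - v + v ^ 2 := by
  have hp0 : 0 < p := by linarith
  have h1 : v / p ≤ 1 := by rw [div_le_one hp0]; linarith
  have h2 : 1 - v / p ≤ Real.exp (-(v / p)) := by
    have := Real.add_one_le_exp (-(v / p))
    linarith
  have h3 : (1 - v / p) ^ p ≤ Real.exp (-v) := by
    refine (Real.rpow_le_rpow (by linarith) h2 hp0.le).trans (le_of_eq ?_)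
    rw [← Real.exp_mul]
    congr 1
    field_simp
  have h4 := (abs_le.1 (Real.abs_exp_sub_one_sub_id_le (x := -v)
    (by rwa [abs_neg, abs_of_nonneg hv0]))).2
  nlinarith

theorem hardEdge_radius_bounds {d N c : ℝ} (hd : 1 ≤ d) (hN : 0 < N) (hc : 0 ≤ c)
    (hcN : c * d ≤ N) :
    N / d - c ≤ N * ((1 / d) ^ (1 / (2 * d)) * (1 - c / (2 * N))) ^ (2 * d) ∧
      N * ((1 / d) ^ (1 / (2 * d)) * (1 - c / (2 * N))) ^ (2 * d) ≤
        N / d - c + d * c ^ 2 / N := by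
  have hd0 : 0 < d := by linarith
  have hv1 : c * d / N ≤ 1 := by rwa [div_le_one hN]
  have hv0 : 0 ≤ c * d / N := by positivity
  have e1 : c / (2 * N) = c * d / N / (2 * d) := by field_simp
  have hu : c * d / N / (2 * d) ≤ 1 := by
    rw [div_le_one (by positivity)]; linarith
  have e2 : ((1 / d) ^ (1 / (2 * d)) * (1 - c * d / N / (2 * d))) ^ (2 * d) =
      1 / d * (1 - c * d / N / (2 * d)) ^ (2 * d) := by
    rw [Real.mul_rpow (by positivity) (by linarith), ← Real.rpow_mul (by positivity),
      one_div_mul_cancel (by positivity), Real.rpow_one]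
  rw [e1, e2, ← mul_assoc, mul_one_div]
  have hND : 0 ≤ N / d := by positivity
  have h1 := mul_le_mul_of_nonneg_left
    (one_add_mul_self_le_rpow_one_add (s := -(c * d / N / (2 * d))) (by linarith)
      (p := 2 * d) (by linarith)) hND
  have h2 := mul_le_mul_of_nonneg_left
    (one_sub_div_rpow_le (p := 2 * d) (by linarith) hv0 hv1) hND
  have e3 : N / d * (1 + 2 * d * -(c * d / N / (2 * d))) = N / d - c := by
    field_simp
    ring
  have e4 : N / d * (1 - c * d / N + (c * d / N) ^ 2) = N / d - c + d * c ^ 2 / N := by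
    field_simp
  rw [e3, ← sub_eq_add_neg] at h1
  rw [e4] at h2
  exact ⟨h1, h2⟩

theorem prod_one_sub_le_exp_neg_sum {ι : Type*} (s : Finset ι) (f : ι → ℝ)
    (hf : ∀ i ∈ s, f i ≤ 1) : ∏ i ∈ s, (1 - f i) ≤ Real.exp (-∑ i ∈ s, f i) := by
  rw [← Finset.sum_neg_distrib, Real.exp_sum]
  refine Finset.prod_le_prod (fun i hi => by linarith [hf i hi]) fun i _ => ?_
  have := Real.add_one_le_exp (-f i)
  linarith

theorem exp_neg_sum_le_prod_one_sub {ι : Type*} (s : Finset ι) (f : ι → ℝ) {δ : ℝ}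
    (hδ : δ ≤ 1 / 2) (h0 : ∀ i ∈ s, 0 ≤ f i) (hf : ∀ i ∈ s, f i ≤ δ) :
    Real.exp (-((1 + 2 * δ) * ∑ i ∈ s, f i)) ≤ ∏ i ∈ s, (1 - f i) := by
  rw [Finset.mul_sum, ← Finset.sum_neg_distrib, Real.exp_sum]
  refine Finset.prod_le_prod (fun i _ => (Real.exp_pos _).le) fun i hi => ?_
  have h1 := h0 i hi
  have h2 := hf i hi
  rw [← Real.le_log_iff_exp_le (by linarith)]
  refine le_trans ?_ (neg_sub_two_mul_sq_le_log_one_sub (h2.trans hδ))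
  nlinarith

theorem hardEdge_tail_bounds {d m κ z c Y : ℝ} (hd : 0 < d) (hm : 4 * d ≤ m) (hκ : 0 ≤ κ)
    (hκm : κ < m ^ 2) (hz0 : 0 ≤ z) (hzc : m * z ≤ c) (hcz : c - d * Y ^ 2 / m ^ 2 ≤ m * z)
    (hcY : c ≤ Y) (hY : 2 * d * Y ≤ m ^ 2) :
    (c - d * Y ^ 2 / m ^ 2) * Real.exp (-(2 * d * Y ^ 2 / m ^ 2)) *
        (Real.exp (0 * (κ / m ^ 2)) / (m * hardEdgeMass d m κ)) ≤
      (∫ w in (0 : ℝ)..z, hardEdgeKernel d m κ w) / hardEdgeMass d m κ ∧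
    (∫ w in (0 : ℝ)..z, hardEdgeKernel d m κ w) / hardEdgeMass d m κ ≤
      c * (1 + 2 * d * Y / m ^ 2) * (Real.exp (Y * (κ / m ^ 2)) / (m * hardEdgeMass d m κ)) := by
  have hm0 : 0 < m := by linarith
  have hM := hardEdgeMass_pos hd hm hκ hκm
  have hc : 0 ≤ c := (mul_nonneg hm0.le hz0).trans hzc
  have hY0 : 0 ≤ Y := hc.trans hcY
  have hzY : m * z ≤ Y := hzc.trans hcY
  have e1 : d * z / m = d * (m * z) / m ^ 2 := by field_simp
  have hx : d * z / m ≤ d * Y / m ^ 2 := by rw [e1]; gcongr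
  have hx2 : d * z / m ≤ 1 / 2 := by
    refine hx.trans ?_
    rw [div_le_iff₀ (by positivity)]
    linarith
  constructor
  · rw [zero_mul, Real.exp_zero, mul_one_div, ← div_div]
    refine div_le_div_of_nonneg_right ?_ hM.le
    refine le_trans ?_ (mul_exp_le_integral_hardEdgeKernel hd hm0 hκ hκm hz0 hx2)
    rw [div_le_iff₀ hm0]
    have e2 : 2 * d * z ^ 2 = 2 * d * (m * z) ^ 2 / m ^ 2 := by field_simp
    have h1 : Real.exp (-(2 * d * Y ^ 2 / m ^ 2)) ≤ Real.exp (-(2 * d * z ^ 2)) := by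
      rw [Real.exp_le_exp, e2]
      gcongr
    calc _ ≤ m * z * Real.exp (-(2 * d * Y ^ 2 / m ^ 2)) := by gcongr
      _ ≤ m * z * Real.exp (-(2 * d * z ^ 2)) := by gcongr
      _ = _ := by ring
  · rw [mul_div_assoc', ← div_div]
    refine div_le_div_of_nonneg_right ?_ hM.le
    refine (integral_hardEdgeKernel_le hd hm0 hκ hκm hz0 hx2).trans ?_
    rw [le_div_iff₀ hm0]
    have h1 : κ * z / m ≤ Y * (κ / m ^ 2) := by
      have : κ * z / m = m * z * (κ / m ^ 2) := by field_simp
      rw [this]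
      gcongr
    have h2 : 1 + 2 * (d * z / m) ≤ 1 + 2 * d * Y / m ^ 2 := by
      have : 2 * d * Y / m ^ 2 = 2 * (d * Y / m ^ 2) := by ring
      linarith
    have h3 : 0 ≤ c * (1 + 2 * d * Y / m ^ 2) := by positivity
    calc z * ((1 + 2 * (d * z / m)) * Real.exp (κ * z / m)) * m
        = m * z * (1 + 2 * (d * z / m)) * Real.exp (κ * z / m) := by ring
      _ ≤ _ := by gcongr

theorem hardEdge_prod_bounds {d c Y : ℝ} (hd : 1 ≤ d) (hc : 0 ≤ c) (hcY : c ≤ Y) {n : ℕ}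
    (hn : 4 * d ≤ √(n : ℝ)) (hY : 2 * d * Y ≤ n) {δ : ℝ}
    (hδ : 2 * Y * Real.exp (Y + 8 * d) / √n = δ) (hδ2 : δ ≤ 1 / 2) :
    let P := ∏ j ∈ Finset.range n,
          (1 - (∫ t in
                  ((n : ℝ) * ((1 / d) ^ (1 / (2 * d)) *
                      (1 - c / (2 * n))) ^ (2 * d))..((n : ℝ) / d),
                  t ^ (((j : ℝ) + 1) / d - 1) * Real.exp (-t)) /
               lowerGamma (((j : ℝ) + 1) / d) ((n : ℝ) / d))
    let S := fun Y : ℝ => ∑ k ∈ Finset.range n,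
      Real.exp (Y * (k / n)) / (√n * hardEdgeMass d √n k)
    Real.exp (-((1 + 2 * δ) * (c * (1 + 2 * d * Y / n) * S Y))) ≤ P ∧
      P ≤ Real.exp (-((c - d * Y ^ 2 / n) * Real.exp (-(2 * d * Y ^ 2 / n)) * S 0)) := by
  intro P S
  have hd0 : 0 < d := by linarith
  have hm0 : 0 < √(n : ℝ) := by linarith
  have hn0 : (0 : ℝ) < n := Real.sqrt_pos.1 hm0
  have hsq : √(n : ℝ) ^ 2 = n := Real.sq_sqrt hn0.le
  have hY0 : 0 ≤ Y := hc.trans hcY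
  have hcd : 2 * (c * d) ≤ n := by nlinarith
  obtain ⟨hL1, hL2⟩ := hardEdge_radius_bounds hd hn0 hc (by nlinarith)
  set L := (n : ℝ) * ((1 / d) ^ (1 / (2 * d)) * (1 - c / (2 * n))) ^ (2 * d) with hL
  set z := (n / d - L) / √(n : ℝ) with hz
  have hmz : √(n : ℝ) * z = n / d - L := by rw [hz]; field_simp
  have hcn : d * c ^ 2 / n ≤ c := by
    rw [div_le_iff₀ hn0]
    nlinarith [mul_nonneg hc hd0.le]
  have hz0 : 0 ≤ z := div_nonneg (by linarith) hm0.le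
  have hzm : z ≤ √(n : ℝ) / d := by
    rw [hz, div_le_div_iff₀ hm0 hd0, ← pow_two, hsq]
    have : 2 * c ≤ n / d := by rw [le_div_iff₀ hd0]; linarith
    have h2 : n / d * d = n := by field_simp
    nlinarith
  have hcz : c - d * Y ^ 2 / √(n : ℝ) ^ 2 ≤ √(n : ℝ) * z := by
    have : d * c ^ 2 / n ≤ d * Y ^ 2 / n := by gcongr
    rw [hsq, hmz]
    linarith
  set f : ℕ → ℝ := fun k =>
    (∫ w in (0 : ℝ)..z, hardEdgeKernel d √n k w) / hardEdgeMass d √n k with hf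
  have hP : P = ∏ k ∈ Finset.range n, (1 - f k) := by
    simp only [P]
    rw [← Finset.prod_range_reflect]
    refine Finset.prod_congr rfl fun k hk => ?_
    have hkn : k < n := Finset.mem_range.1 hk
    have e : (((n - 1 - k : ℕ) : ℝ) + 1) / d = (√(n : ℝ) ^ 2 - k) / d := by
      rw [hsq, Nat.cast_sub (by omega), Nat.cast_sub (by omega)]
      push_cast
      ring
    have h := integral_div_lowerGamma_eq (κ := (k : ℝ)) hd0 hm0 hz0 hzm
    rw [hmz, hsq, sub_sub_cancel] at h
    rw [e, hsq, h]
  have hb : ∀ k ∈ Finset.range n, _ := fun k hk =>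
    hardEdge_tail_bounds hd0 hn (Nat.cast_nonneg k)
      (by rw [hsq]; exact_mod_cast Finset.mem_range.1 hk) hz0 (by rw [hmz]; linarith) hcz hcY
      (by rwa [hsq])
  rw [hsq] at hb
  have hf0 : ∀ k ∈ Finset.range n, 0 ≤ f k := fun k hk => by
    have hkn : (k : ℝ) < √(n : ℝ) ^ 2 := by rw [hsq]; exact_mod_cast Finset.mem_range.1 hk
    refine div_nonneg (intervalIntegral.integral_nonneg hz0 fun w hw => hardEdgeKernel_nonneg ?_)
      (hardEdgeMass_pos hd0 hn (Nat.cast_nonneg k) hkn).le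
    rw [div_le_one hm0]
    have := (le_div_iff₀ hd0).1 (hw.2.trans hzm)
    linarith
  have hfδ : ∀ k ∈ Finset.range n, f k ≤ δ := fun k hk => by
    have hkn' : (k : ℝ) < n := by exact_mod_cast Finset.mem_range.1 hk
    have hkn : (k : ℝ) < √(n : ℝ) ^ 2 := by rwa [hsq]
    have hpos := hardEdgeMass_pos hd0 hn (Nat.cast_nonneg k) hkn
    refine (hb k hk).2.trans ?_
    have h1 : Real.exp (Y * (k / n)) / (√n * hardEdgeMass d √n k) ≤
        Real.exp (Y + 8 * d) / √n := by
      rw [← div_div, div_right_comm]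
      refine div_le_div_of_nonneg_right ?_ hm0.le
      rw [div_le_iff₀ hpos]
      have h2 : (k : ℝ) / n ≤ 1 := div_le_one_of_le₀ hkn'.le hn0.le
      have h3 : 0 ≤ (k : ℝ) / √n := by positivity
      calc Real.exp (Y * (k / n)) ≤ Real.exp (Y + 8 * d) * Real.exp (k / √n - 8 * d) := by
            rw [← Real.exp_add, Real.exp_le_exp]
            nlinarith
        _ ≤ _ := by gcongr; exact exp_le_hardEdgeMass hd0 hn (Nat.cast_nonneg k) hkn
    have h4 : 2 * d * Y / n ≤ 1 := div_le_one_of_le₀ hY hn0.le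
    calc _ ≤ Y * (1 + 1) * (Real.exp (Y + 8 * d) / √n) := by gcongr
      _ = δ := by rw [← hδ]; ring
  have hδ0 : 0 ≤ δ := by rw [← hδ]; positivity
  rw [hP]
  constructor
  · refine le_trans ?_ (exp_neg_sum_le_prod_one_sub _ f hδ2 hf0 hfδ)
    rw [Real.exp_le_exp, neg_le_neg_iff]
    refine mul_le_mul_of_nonneg_left ?_ (by linarith)
    simp only [S]
    rw [Finset.mul_sum]
    exact Finset.sum_le_sum fun k hk => (hb k hk).2
  · refine (prod_one_sub_le_exp_neg_sum _ f fun k hk => ?_).trans ?_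
    · linarith [hfδ k hk]
    rw [Real.exp_le_exp, neg_le_neg_iff]
    simp only [S]
    rw [Finset.mul_sum]
    exact Finset.sum_le_sum fun k hk => (hb k hk).1

/-- Hard edge power case `Q(z) = |z|^{2d}`, `d ≥ 1`: with
`x_n = (1/d)^{1/(2d)} (1 + ξ/(d n log 4))`,
`∏_{j=0}^{n−1} (1 − (∫_{n x_n^{2d}}^{n/d} t^{(j+1)/d − 1} e^{−t} dt) / γ((j+1)/d, n/d)) → e^ξ`,
uniformly for `ξ` in compact subsets of `(−∞, 0]`. -/
theorem hard_edge_power_spectral_radius (d : ℝ) (hd : 1 ≤ d)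
    (K : Set ℝ) (hK : IsCompact K) (hK' : K ⊆ Set.Iic 0) :
    TendstoUniformlyOn
      (fun (n : ℕ) (ξ : ℝ) =>
        ∏ j ∈ Finset.range n,
          (1 - (∫ t in
                  ((n : ℝ) * ((1 / d) ^ (1 / (2 * d)) *
                      (1 + ξ / (d * n * Real.log 4))) ^ (2 * d))..((n : ℝ) / d),
                  t ^ (((j : ℝ) + 1) / d - 1) * Real.exp (-t)) /
               lowerGamma (((j : ℝ) + 1) / d) ((n : ℝ) / d)))
      (fun ξ => Real.exp ξ) atTop K := by
  have hd0 : 0 < d := by linarith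
  have hl4 : Real.log 4 = 2 * Real.log 2 := by
    rw [show (4 : ℝ) = 2 ^ 2 by norm_num, Real.log_pow]
    norm_num
  have hl2 : 0 < Real.log 2 := Real.log_pos one_lt_two
  rw [← tendstoLocallyUniformlyOn_iff_tendstoUniformlyOn_of_compact hK,
    tendstoLocallyUniformlyOn_iff_forall_tendsto]
  intro ξ₀ hξ₀
  have hfst : Tendsto Prod.fst (atTop (α := ℕ) ×ˢ nhdsWithin ξ₀ K) atTop := tendsto_fst
  have hsnd : Tendsto Prod.snd (atTop (α := ℕ) ×ˢ nhdsWithin ξ₀ K) (nhds ξ₀) :=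
    tendsto_snd.mono_right nhdsWithin_le_nhds
  have hmem : ∀ᶠ q : ℕ × ℝ in atTop ×ˢ nhdsWithin ξ₀ K, q.2 ≤ 0 :=
    (tendsto_snd.eventually self_mem_nhdsWithin).mono fun q hq => hK' hq
  have hlim : Tendsto (fun q : ℕ × ℝ => Real.exp q.2) (atTop ×ˢ nhdsWithin ξ₀ K)
      (nhds (Real.exp ξ₀)) := (Real.continuous_exp.tendsto _).comp hsnd
  refine Tendsto.mono_right (hlim.prodMk_nhds ?_) (nhds_le_uniformity _)
  set Y : ℝ := (1 - ξ₀) / (d * Real.log 2) with hYdef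
  have hY0 : 0 ≤ Y := div_nonneg (by linarith [show ξ₀ ≤ 0 from hK' hξ₀]) (by positivity)
  have hn : Tendsto (fun n : ℕ => (n : ℝ)) atTop atTop := tendsto_natCast_atTop_atTop
  have hm : Tendsto (fun n : ℕ => √(n : ℝ)) atTop atTop := Real.tendsto_sqrt_atTop.comp hn
  have hδ : Tendsto (fun n : ℕ => 2 * Y * Real.exp (Y + 8 * d) / √(n : ℝ)) atTop (nhds 0) :=
    hm.const_div_atTop _
  have hc : Tendsto (fun q : ℕ × ℝ => -q.2 / (d * Real.log 2)) (atTop ×ˢ nhdsWithin ξ₀ K)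
      (nhds (-ξ₀ / (d * Real.log 2))) := hsnd.neg.div_const _
  have hcY : ∀ᶠ q : ℕ × ℝ in atTop ×ˢ nhdsWithin ξ₀ K, -q.2 / (d * Real.log 2) < Y :=
    hc.eventually_lt_const (by rw [hYdef]; gcongr; linarith)
  have hbounds := (((hmem.and hcY).and (hfst.eventually (hm.eventually_ge_atTop (4 * d)))).and
    ((hfst.eventually (hn.eventually_ge_atTop (2 * d * Y))).and
      (hfst.eventually (hδ.eventually_le_const (by norm_num : (0 : ℝ) < 1 / 2))))).mono
    fun q hq => hardEdge_prod_bounds hd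
      (div_nonneg (neg_nonneg.2 hq.1.1.1) (mul_nonneg hd0.le hl2.le)) hq.1.1.2.le hq.1.2
      hq.2.1 rfl hq.2.2
  have e : ∀ q : ℕ × ℝ, 1 - -q.2 / (d * Real.log 2) / (2 * q.1) =
      1 + q.2 / (d * q.1 * Real.log 4) := by
    intro q
    rw [hl4, neg_div, neg_div, sub_neg_eq_add, div_div]
    congr 2
    ring
  simp only [e] at hbounds
  have hA : Tendsto (fun q : ℕ × ℝ => -((1 + 2 * (2 * Y * Real.exp (Y + 8 * d) / √(q.1 : ℝ))) *
      (-q.2 / (d * Real.log 2) * (1 + 2 * d * Y / q.1) * ∑ k ∈ Finset.range q.1,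
        Real.exp (Y * (k / q.1)) / (√q.1 * hardEdgeMass d √q.1 k))))
      (atTop ×ˢ nhdsWithin ξ₀ K) (nhds ξ₀) := by
    have h := (((hδ.comp hfst).const_mul 2).const_add 1).mul
      ((hc.mul (((hn.const_div_atTop (2 * d * Y)).comp hfst).const_add 1)).mul
        ((tendsto_sum_exp_div_hardEdgeMass hd0 hY0).comp hfst)) |>.neg
    have e0 : -((1 + 2 * 0) * (-ξ₀ / (d * Real.log 2) * (1 + 0) * (d * Real.log 2))) = ξ₀ := by
      field_simp
      ring
    rw [e0] at h
    exact h
  have hB : Tendsto (fun q : ℕ × ℝ => -((-q.2 / (d * Real.log 2) - d * Y ^ 2 / q.1) *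
      Real.exp (-(2 * d * Y ^ 2 / q.1)) * ∑ k ∈ Finset.range q.1,
        Real.exp (0 * (k / q.1)) / (√q.1 * hardEdgeMass d √q.1 k)))
      (atTop ×ˢ nhdsWithin ξ₀ K) (nhds ξ₀) := by
    have hE := (Real.continuous_exp.tendsto _).comp
      ((hn.const_div_atTop (2 * d * Y ^ 2)).neg)
    have h := ((hc.sub ((hn.const_div_atTop (d * Y ^ 2)).comp hfst)).mul (hE.comp hfst)).mul
        ((tendsto_sum_exp_div_hardEdgeMass hd0 le_rfl).comp hfst) |>.neg
    have e0 : -((-ξ₀ / (d * Real.log 2) - 0) * Real.exp (-0) * (d * Real.log 2)) = ξ₀ := by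
      rw [neg_zero, Real.exp_zero]
      field_simp
      ring
    rw [e0] at h
    exact h
  exact tendsto_of_tendsto_of_tendsto_of_le_of_le' ((Real.continuous_exp.tendsto _).comp hA)
    ((Real.continuous_exp.tendsto _).comp hB) (hbounds.mono fun q hq => hq.1)
    (hbounds.mono fun q hq => hq.2)
end

section
/- (Hard edge Ginibre case.) For ξ ≤ 0 define x_n = 1 + ξ/(n log 4). Then lim_{n→∞} ∏_{j=0}^{n−1} ( 1 − (∫_{n x_n^{2}}^{n} t^{j} e^{−t} dt) / γ(j+1, n) ) = e^{ξ}, uniformly for ξ in compact subsets of (−∞, 0]. (This product is the probability that the rescaled spectral radius ω_n = n(|z|_n − 1) log 4 of the hard edge Ginibre ensemble is at most ξ.) -/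
open MeasureTheory Filter Finset

open scoped Topology Nat

/-- The integral `∫_0^x t^j e^(-t) dt`, for a natural exponent `j`. -/
noncomputable def powExpIntegral (x : ℝ) (j : ℕ) : ℝ :=
  ∫ t in (0 : ℝ)..x, t ^ j * Real.exp (-t)

/-- The value at `t = x` of the probability density on `[0, x]` proportional to `t^j e^(-t)`. -/
noncomputable def endpointDensity (x : ℝ) (j : ℕ) : ℝ :=
  x ^ j * Real.exp (-x) / powExpIntegral x j

lemma lowerGamma_natCast_add_one (x : ℝ) (j : ℕ) :
    lowerGamma ((j : ℝ) + 1) x = powExpIntegral x j := by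
  simp [lowerGamma, powExpIntegral]

lemma intervalIntegrable_pow_mul_exp_neg (j : ℕ) (a b : ℝ) :
    IntervalIntegrable (fun t : ℝ => t ^ j * Real.exp (-t)) volume a b :=
  Continuous.intervalIntegrable (by fun_prop) a b

lemma powExpIntegral_pos {x : ℝ} (hx : 0 < x) (j : ℕ) : 0 < powExpIntegral x j := by
  refine intervalIntegral.intervalIntegral_pos_of_pos_on
    (intervalIntegrable_pow_mul_exp_neg j 0 x) (fun t ht => ?_) hx
  have := ht.1
  positivity

lemma powExpIntegral_zero (x : ℝ) : powExpIntegral x 0 = 1 - Real.exp (-x) := by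
  simp [powExpIntegral]

lemma powExpIntegral_succ (x : ℝ) (j : ℕ) :
    powExpIntegral x (j + 1) = (j + 1) * powExpIntegral x j - x ^ (j + 1) * Real.exp (-x) := by
  have hderiv : ∀ t ∈ Set.uIcc 0 x, HasDerivAt (fun t : ℝ => t ^ (j + 1) * Real.exp (-t))
      ((j + 1) * (t ^ j * Real.exp (-t)) - t ^ (j + 1) * Real.exp (-t)) t := by
    intro t _
    refine ((hasDerivAt_pow (j + 1) t).fun_mul (hasDerivAt_neg t).exp).congr_deriv ?_
    push_cast
    ring
  have h := intervalIntegral.integral_eq_sub_of_hasDerivAt hderiv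
    (Continuous.intervalIntegrable (by fun_prop) 0 x)
  rw [intervalIntegral.integral_sub ((intervalIntegrable_pow_mul_exp_neg j 0 x).const_mul _)
    (intervalIntegrable_pow_mul_exp_neg (j + 1) 0 x), intervalIntegral.integral_const_mul] at h
  simp only [powExpIntegral]
  simp at h
  linarith

lemma powExpIntegral_succ_le {x : ℝ} (hx : 0 ≤ x) (j : ℕ) :
    powExpIntegral x (j + 1) ≤ x * powExpIntegral x j := by
  unfold powExpIntegral
  rw [← intervalIntegral.integral_const_mul]
  refine intervalIntegral.integral_mono_on hx (intervalIntegrable_pow_mul_exp_neg (j + 1) 0 x)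
    ((intervalIntegrable_pow_mul_exp_neg j 0 x).const_mul _) (fun t ht => ?_)
  have := ht.1
  rw [pow_succ', mul_assoc]
  exact mul_le_mul_of_nonneg_right ht.2 (by positivity)

lemma endpointDensity_pos {x : ℝ} (hx : 0 < x) (j : ℕ) : 0 < endpointDensity x j := by
  have := powExpIntegral_pos hx j
  unfold endpointDensity
  positivity

lemma endpointDensity_mono {x : ℝ} (hx : 0 < x) : Monotone (endpointDensity x) := by
  refine monotone_nat_of_le_succ fun j => ?_
  have h0 := powExpIntegral_pos hx j
  have h1 := powExpIntegral_pos hx (j + 1)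
  unfold endpointDensity
  rw [div_le_div_iff₀ h0 h1]
  calc x ^ j * Real.exp (-x) * powExpIntegral x (j + 1)
      ≤ x ^ j * Real.exp (-x) * (x * powExpIntegral x j) :=
        mul_le_mul_of_nonneg_left (powExpIntegral_succ_le hx.le j) (by positivity)
    _ = _ := by ring

lemma prod_one_add_endpointDensity {x : ℝ} (hx : 0 < x) (k : ℕ) :
    ∏ j ∈ range (k + 1), (1 + endpointDensity x j) = (k ! : ℝ) / powExpIntegral x k := by
  induction k with
  | zero =>
    have h := powExpIntegral_pos hx 0
    have h0 := powExpIntegral_zero x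
    simp only [zero_add, prod_range_one, endpointDensity, pow_zero, one_mul, Nat.factorial_zero,
      Nat.cast_one]
    field_simp
    linarith
  | succ k ih =>
    have h := powExpIntegral_pos hx k
    have h1 := powExpIntegral_pos hx (k + 1)
    have hrec := powExpIntegral_succ x k
    rw [prod_range_succ, ih, endpointDensity, Nat.factorial_succ]
    push_cast
    have : 1 + x ^ (k + 1) * Real.exp (-x) / powExpIntegral x (k + 1)
        = (k + 1) * powExpIntegral x k / powExpIntegral x (k + 1) := by
      field_simp
      linarith
    rw [this]
    field_simp

lemma sum_one_sub_div_mul_endpointDensity_le {x : ℝ} (hx : 0 < x) (k : ℕ) :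
    ∑ j ∈ range (k + 1), (1 - j / x) * endpointDensity x j ≤ endpointDensity x k := by
  induction k with
  | zero => simp
  | succ k ih =>
    have h := powExpIntegral_pos hx k
    have h1 := powExpIntegral_pos hx (k + 1)
    have hrec := powExpIntegral_succ x k
    have key : endpointDensity x k ≤ ((k + 1 : ℕ) : ℝ) / x * endpointDensity x (k + 1) := by
      have : ((k + 1 : ℕ) : ℝ) / x * endpointDensity x (k + 1)
          = (x ^ k * Real.exp (-x) * (k + 1)) / powExpIntegral x (k + 1) := by
        unfold endpointDensity
        push_cast
        field_simp
        ring
      rw [this, endpointDensity, div_le_div_iff₀ h h1, mul_assoc (x ^ k * Real.exp (-x))]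
      refine mul_le_mul_of_nonneg_left ?_ (by positivity)
      have : 0 < x ^ (k + 1) * Real.exp (-x) := by positivity
      linarith
    rw [sum_range_succ]
    linarith

lemma one_sub_pow_mul_exp_le {n : ℕ} {x : ℝ} (hx : 0 ≤ x) (hx1 : x ≤ 1) :
    (1 - x) ^ n * Real.exp (n * x) ≤ Real.exp (-(n * x ^ 2 / 2)) := by
  have h : 1 - x ≤ Real.exp (-x - x ^ 2 / 2) := by
    rcases hx1.eq_or_lt with rfl | hlt
    · simpa using (Real.exp_pos _).le
    · have hs := Real.hasSum_pow_div_log_of_abs_lt_one (x := x) (by rwa [abs_of_nonneg hx])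
      have := sum_le_hasSum (range 2) (fun i _ => by positivity) hs
      simp only [sum_range_succ, sum_range_zero] at this
      norm_num at this
      rw [← Real.log_le_iff_le_exp (by linarith)]
      linarith
  calc (1 - x) ^ n * Real.exp (n * x)
      ≤ Real.exp (-x - x ^ 2 / 2) ^ n * Real.exp (n * x) := by
        gcongr
    _ = _ := by
        rw [← Real.exp_nat_mul, ← Real.exp_add]
        ring_nf

lemma tendsto_one_sub_div_sqrt_pow_mul_exp (u : ℝ) (hu : 0 < u) :
    Tendsto (fun n : ℕ => (1 - u / √n) ^ n * Real.exp (√n * u)) atTop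
      (𝓝 (Real.exp (-(u ^ 2 / 2)))) := by
  have hsqrt : Tendsto (fun n : ℕ => √(n : ℝ)) atTop atTop :=
    Real.tendsto_sqrt_atTop.comp tendsto_natCast_atTop_atTop
  have hx : Tendsto (fun n : ℕ => u / √n) atTop (𝓝 0) := hsqrt.const_div_atTop u
  have hlog : Tendsto (fun n : ℕ => (n : ℝ) * Real.log (1 - u / √n) + √n * u) atTop
      (𝓝 (-(u ^ 2 / 2))) := by
    rw [tendsto_iff_norm_sub_tendsto_zero]
    have hbound : Tendsto (fun n : ℕ => u ^ 2 * (u / √n) / (1 - u / √n)) atTop (𝓝 0) := by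
      have := (hx.const_mul (u ^ 2)).div (tendsto_const_nhds.sub hx) (by norm_num : (1 : ℝ) - 0 ≠ 0)
      simpa [Pi.div_def] using this
    refine squeeze_zero' (Eventually.of_forall fun _ => norm_nonneg _) ?_ hbound
    filter_upwards [hx.eventually (gt_mem_nhds one_pos), eventually_gt_atTop 0] with n hn hn0
    have hnR : (0 : ℝ) < n := by exact_mod_cast hn0
    have hs : 0 < √(n : ℝ) := Real.sqrt_pos.2 hnR
    have hsq : √(n : ℝ) ^ 2 = n := Real.sq_sqrt hnR.le
    have hpos : 0 < u / √n := by positivity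
    have h := Real.abs_log_sub_add_sum_range_le (x := u / √n) (by rwa [abs_of_pos hpos]) 2
    simp only [sum_range_succ, sum_range_zero] at h
    norm_num at h
    rw [abs_of_pos hpos] at h
    have e1 : (n : ℝ) * Real.log (1 - u / √n) + √n * u - -(u ^ 2 / 2)
        = n * (u / √n + (u / √n) ^ 2 / 2 + Real.log (1 - u / √n)) := by
      rw [← hsq]
      field_simp
      rw [Real.sqrt_sq hs.le]
      ring
    have e2 : u ^ 2 * (u / √n) / (1 - u / √n) = n * ((u / √n) ^ 3 / (1 - u / √n)) := by
      nth_rewrite 3 [← hsq]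
      field_simp
    rw [e1, e2, Real.norm_eq_abs, abs_mul, abs_of_pos hnR]
    exact mul_le_mul_of_nonneg_left h hnR.le
  refine ((Real.continuous_exp.tendsto _).comp hlog).congr' ?_
  filter_upwards [hx.eventually (gt_mem_nhds one_pos)] with n hn
  simp only [Function.comp]
  rw [Real.exp_add, Real.exp_nat_mul, Real.exp_log (by linarith)]

lemma powExpIntegral_self_eq {n : ℕ} (hn : 0 < n) :
    powExpIntegral n n = (n : ℝ) ^ n * Real.exp (-n) * √n *
      ∫ u in Set.Ioi (0 : ℝ), (Set.Ioc 0 √(n : ℝ)).indicator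
        (fun u => (1 - u / √n) ^ n * Real.exp (√n * u)) u := by
  have hnR : (0 : ℝ) < n := by exact_mod_cast hn
  have hs : 0 < √(n : ℝ) := Real.sqrt_pos.2 hnR
  have hsq : √(n : ℝ) * √n = n := Real.mul_self_sqrt hnR.le
  rw [setIntegral_indicator measurableSet_Ioc,
    Set.inter_eq_self_of_subset_right Set.Ioc_subset_Ioi_self,
    ← intervalIntegral.integral_of_le hs.le]
  have h := intervalIntegral.integral_comp_sub_mul (a := 0) (b := √(n : ℝ))
    (fun t : ℝ => t ^ n * Real.exp (-t)) hs.ne' (n : ℝ)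
  rw [hsq, sub_self, mul_zero, sub_zero, smul_eq_mul] at h
  have h2 : powExpIntegral n n = √n * ∫ u in (0 : ℝ)..√n,
      (n - √n * u) ^ n * Real.exp (-(n - √n * u)) := by
    rw [h, powExpIntegral]
    field_simp
  have h3 : ∫ u in (0 : ℝ)..√n, (n - √n * u) ^ n * Real.exp (-(n - √n * u)) =
      ∫ u in (0 : ℝ)..√n,
        (n : ℝ) ^ n * Real.exp (-n) * ((1 - u / √n) ^ n * Real.exp (√n * u)) := by
    refine intervalIntegral.integral_congr fun u _ => ?_
    have e1 : (n : ℝ) - √n * u = n * (1 - u / √n) := by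
      nth_rewrite 1 3 [← hsq]
      field_simp
    have e2 : Real.exp (-((n : ℝ) - √n * u)) = Real.exp (-n) * Real.exp (√n * u) := by
      rw [← Real.exp_add]
      congr 1
      ring
    rw [e2, e1, mul_pow]
    ring
  rw [h2, h3, intervalIntegral.integral_const_mul]
  ring

lemma tendsto_integral_indicator_one_sub_div_sqrt_pow :
    Tendsto (fun n : ℕ => ∫ u in Set.Ioi (0 : ℝ), (Set.Ioc 0 √(n : ℝ)).indicator
        (fun u => (1 - u / √n) ^ n * Real.exp (√n * u)) u) atTop
      (𝓝 (√(2 * Real.pi) / 2)) := by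
  have hsqrt : Tendsto (fun n : ℕ => √(n : ℝ)) atTop atTop :=
    Real.tendsto_sqrt_atTop.comp tendsto_natCast_atTop_atTop
  have hval : ∫ u in Set.Ioi (0 : ℝ), Real.exp (-(1 / 2) * u ^ 2) = √(2 * Real.pi) / 2 := by
    rw [integral_gaussian_Ioi]
    congr 2
    ring
  rw [← hval]
  refine tendsto_integral_of_dominated_convergence (fun u => Real.exp (-(1 / 2) * u ^ 2))
    (fun n => ?_) (integrable_exp_neg_mul_sq (by norm_num)).integrableOn (fun n => ?_) ?_
  · refine (Measurable.indicator ?_ measurableSet_Ioc).aestronglyMeasurable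
    fun_prop
  · refine Eventually.of_forall fun u => ?_
    by_cases hu : u ∈ Set.Ioc 0 √(n : ℝ)
    · have hs : 0 < √(n : ℝ) := hu.1.trans_le hu.2
      have hnR : (0 : ℝ) < n := Real.sqrt_pos.1 hs
      have hsq : √(n : ℝ) ^ 2 = n := Real.sq_sqrt hnR.le
      have hx0 : 0 ≤ u / √n := div_nonneg hu.1.le hs.le
      have hx1 : u / √n ≤ 1 := (div_le_one hs).2 hu.2
      have h := one_sub_pow_mul_exp_le (n := n) hx0 hx1
      have e1 : (n : ℝ) * (u / √n) = √n * u := by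
        nth_rewrite 1 [← hsq]
        field_simp
      have e2 : -((n : ℝ) * (u / √n) ^ 2 / 2) = -(1 / 2) * u ^ 2 := by
        rw [div_pow, hsq]
        field_simp
      rw [e1, e2] at h
      rw [Set.indicator_of_mem hu, Real.norm_of_nonneg]
      · exact h
      · exact mul_nonneg (pow_nonneg (by linarith) _) (Real.exp_pos _).le
    · rw [Set.indicator_of_notMem hu, norm_zero]
      positivity
  · refine (ae_restrict_iff' measurableSet_Ioi).2 (Eventually.of_forall fun u hu => ?_)
    have h := tendsto_one_sub_div_sqrt_pow_mul_exp u hu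
    have e : -(u ^ 2 / 2) = -(1 / 2) * u ^ 2 := by ring
    rw [e] at h
    refine h.congr' ?_
    filter_upwards [hsqrt.eventually_ge_atTop u] with n hn
    have hmem : u ∈ Set.Ioc 0 √(n : ℝ) := ⟨hu, hn⟩
    rw [Set.indicator_of_mem hmem]

lemma tendsto_factorial_div_powExpIntegral :
    Tendsto (fun n : ℕ => (n ! : ℝ) / powExpIntegral n n) atTop (𝓝 2) := by
  have h := (Stirling.tendsto_stirlingSeq_sqrt_pi.mul_const √2).div
    tendsto_integral_indicator_one_sub_div_sqrt_pow
    (by positivity)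
  have e : √Real.pi * √2 / (√(2 * Real.pi) / 2) = 2 := by
    rw [Real.sqrt_mul (by norm_num)]
    field_simp
  rw [e] at h
  refine h.congr' ?_
  filter_upwards [eventually_gt_atTop 0] with n hn
  have hnR : (0 : ℝ) < n := by exact_mod_cast hn
  simp only [Pi.div_apply]
  rw [powExpIntegral_self_eq hn, Stirling.stirlingSeq, Real.sqrt_mul (by norm_num), div_pow,
    ← Real.exp_nat_mul, mul_one, Real.exp_neg]
  field_simp

lemma tendsto_endpointDensity_self :
    Tendsto (fun n : ℕ => endpointDensity n n) atTop (𝓝 0) := by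
  have hsqrt : Tendsto (fun n : ℕ => √(n : ℝ)) atTop atTop :=
    Real.tendsto_sqrt_atTop.comp tendsto_natCast_atTop_atTop
  have h := hsqrt.inv_tendsto_atTop.div tendsto_integral_indicator_one_sub_div_sqrt_pow
    (by positivity)
  rw [zero_div] at h
  refine h.congr' ?_
  filter_upwards [eventually_gt_atTop 0] with n hn
  have hnR : (0 : ℝ) < n := by exact_mod_cast hn
  simp only [Pi.div_apply, Pi.inv_apply]
  rw [endpointDensity, powExpIntegral_self_eq hn]
  field_simp

lemma tendsto_sum_endpointDensity :
    Tendsto (fun n : ℕ => ∑ j ∈ range n, endpointDensity n j) atTop (𝓝 (Real.log 2)) := by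
  have hprod : Tendsto (fun n : ℕ => Real.log (∏ j ∈ range n, (1 + endpointDensity n j))) atTop
      (𝓝 (Real.log 2)) := by
    have h := tendsto_factorial_div_powExpIntegral.div
      (tendsto_endpointDensity_self.const_add 1) (by norm_num)
    rw [add_zero, div_one] at h
    refine (h.log (by norm_num)).congr' ?_
    filter_upwards [eventually_gt_atTop 0] with n hn
    have hnR : (0 : ℝ) < n := by exact_mod_cast hn
    have := endpointDensity_pos hnR n
    simp only [Pi.div_apply]
    rw [← prod_one_add_endpointDensity hnR, prod_range_succ]
    field_simp
  have hupper := (tendsto_endpointDensity_self.const_add 1).mul hprod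
  rw [add_zero, one_mul] at hupper
  refine tendsto_of_tendsto_of_tendsto_of_le_of_le' hprod hupper ?_ ?_
  all_goals
    filter_upwards [eventually_gt_atTop 0] with n hn
    have hnR : (0 : ℝ) < n := by exact_mod_cast hn
    have hpos := endpointDensity_pos hnR
    rw [Real.log_prod (fun j _ => by linarith [hpos j] : ∀ j ∈ range n, 1 + endpointDensity n j ≠ 0)]
  · refine sum_le_sum fun j _ => ?_
    have := Real.log_le_sub_one_of_pos (by linarith [hpos j] : 0 < 1 + endpointDensity n j)
    linarith
  · rw [mul_sum]
    refine sum_le_sum fun j hj => ?_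
    have hp := hpos j
    have hm : endpointDensity n j ≤ endpointDensity n n :=
      endpointDensity_mono hnR (mem_range.1 hj).le
    have hl := Real.one_sub_inv_le_log_of_pos (by linarith : 0 < 1 + endpointDensity n j)
    have e : 1 - (1 + endpointDensity n j)⁻¹ = endpointDensity n j / (1 + endpointDensity n j) := by
      field_simp
      ring
    rw [e, div_le_iff₀ (by linarith)] at hl
    have hlog : 0 ≤ Real.log (1 + endpointDensity n j) := Real.log_nonneg (by linarith)
    nlinarith

lemma pow_mul_exp_neg_le {x s : ℝ} (hx : 0 < x) (hs : s ≤ x) (j : ℕ) :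
    (x - s) ^ j * Real.exp (-(x - s)) ≤
      x ^ j * Real.exp (-x) * Real.exp (s * (1 - j / x)) := by
  have h : x - s ≤ x * Real.exp (-(s / x)) := by
    have h1 := Real.add_one_le_exp (-(s / x))
    calc x - s = x * (-(s / x) + 1) := by field_simp; ring
      _ ≤ _ := mul_le_mul_of_nonneg_left h1 hx.le
  calc (x - s) ^ j * Real.exp (-(x - s))
      ≤ (x * Real.exp (-(s / x))) ^ j * Real.exp (-(x - s)) := by
        gcongr
    _ = x ^ j * (Real.exp (j * -(s / x)) * Real.exp (-(x - s))) := by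
        rw [mul_pow, ← Real.exp_nat_mul, mul_assoc]
    _ = _ := by
        rw [mul_assoc, ← Real.exp_add, ← Real.exp_add]
        congr 2
        field_simp
        ring

lemma le_pow_mul_exp_neg {n j : ℕ} (hn : 0 < n) (hj : j ≤ n) {s : ℝ} (hs0 : 0 ≤ s) (hs : s ≤ n) :
    (n : ℝ) ^ j * Real.exp (-n) * (1 - s ^ 2 / n) ≤ (n - s) ^ j * Real.exp (-(n - s)) := by
  have hnR : (0 : ℝ) < n := by exact_mod_cast hn
  have hx0 : 0 ≤ s / n := by positivity
  have hx1 : s / n ≤ 1 := (div_le_one hnR).2 hs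
  have hbern : 1 - s ^ 2 / n ≤ (1 - s / n) ^ n * (1 + s / n) ^ n := by
    have h := one_add_mul_le_pow (a := -(s / n) ^ 2) (by nlinarith) n
    rw [← mul_pow]
    calc 1 - s ^ 2 / n = 1 + n * -(s / n) ^ 2 := by field_simp; ring
      _ ≤ _ := h
      _ = _ := by ring
  have hexp : (1 + s / n) ^ n ≤ Real.exp s := by
    calc (1 + s / n) ^ n ≤ Real.exp (s / n) ^ n := by
          gcongr
          linarith [Real.add_one_le_exp (s / n)]
      _ = Real.exp s := by
          rw [← Real.exp_nat_mul]
          congr 1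
          field_simp
  have hpow : (1 - s / n) ^ n ≤ (1 - s / n) ^ j :=
    pow_le_pow_of_le_one (by linarith) (by linarith) hj
  have hkey : 1 - s ^ 2 / n ≤ (1 - s / n) ^ j * Real.exp s :=
    hbern.trans (mul_le_mul hpow hexp (by positivity) (pow_nonneg (by linarith) _))
  calc (n : ℝ) ^ j * Real.exp (-n) * (1 - s ^ 2 / n)
      ≤ (n : ℝ) ^ j * Real.exp (-n) * ((1 - s / n) ^ j * Real.exp s) :=
        mul_le_mul_of_nonneg_left hkey (by positivity)
    _ = (n * (1 - s / n)) ^ j * (Real.exp (-n) * Real.exp s) := by rw [mul_pow]; ring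
    _ = _ := by
        rw [← Real.exp_add]
        congr 2
        · field_simp
        · ring

lemma exp_mul_le_one_add {C y : ℝ} (hC : 0 ≤ C) (hy0 : 0 ≤ y) (hy1 : y ≤ 1) :
    Real.exp (C * y) ≤ 1 + C * Real.exp C * y := by
  have h1 : 1 - C * y ≤ Real.exp (-(C * y)) := Real.one_sub_le_exp_neg _
  have h2 : Real.exp (C * y) ≤ Real.exp C :=
    Real.exp_le_exp.2 (mul_le_of_le_one_right hC hy1)
  have h3 : Real.exp (C * y) * Real.exp (-(C * y)) = 1 := by rw [← Real.exp_add]; simp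
  have h4 : Real.exp (C * y) * (1 - C * y) ≤ 1 :=
    (mul_le_mul_of_nonneg_left h1 (Real.exp_pos _).le).trans_eq h3
  have h5 : C * y * Real.exp (C * y) ≤ C * y * Real.exp C :=
    mul_le_mul_of_nonneg_left h2 (mul_nonneg hC hy0)
  linarith

/-- The mass of `[x - l, x]` under the probability density on `[0, x]` proportional to
`t^j e^(-t)`. -/
noncomputable def endpointMass (x l : ℝ) (j : ℕ) : ℝ :=
  (∫ t in (x - l)..x, t ^ j * Real.exp (-t)) / powExpIntegral x j

lemma endpointMass_nonneg {x l : ℝ} (hx : 0 < x) (hl : 0 ≤ l) (hlx : l ≤ x) (j : ℕ) :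
    0 ≤ endpointMass x l j := by
  refine div_nonneg (intervalIntegral.integral_nonneg (by linarith) fun t ht => ?_)
    (powExpIntegral_pos hx j).le
  have : 0 ≤ t := by linarith [ht.1]
  positivity

lemma endpointMass_le {n j : ℕ} (hn : 0 < n) (hj : j ≤ n) {l C : ℝ} (hl : 0 ≤ l) (hlC : l ≤ C)
    (hln : l ≤ n) :
    endpointMass n l j ≤
      l * endpointDensity n j * (1 + C * Real.exp C * (1 - j / n)) := by
  have hnR : (0 : ℝ) < n := by exact_mod_cast hn
  have hG := powExpIntegral_pos hnR j
  have hy0 : 0 ≤ 1 - (j : ℝ) / n := by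
    rw [sub_nonneg, div_le_one hnR]
    exact_mod_cast hj
  have hy1 : 1 - (j : ℝ) / n ≤ 1 := by
    have : 0 ≤ (j : ℝ) / n := by positivity
    linarith
  have hint : ∫ t in (n - l)..(n : ℝ), t ^ j * Real.exp (-t) ≤
      ∫ _ in (n - l)..(n : ℝ),
        (n : ℝ) ^ j * Real.exp (-n) * (1 + C * Real.exp C * (1 - j / n)) := by
    refine intervalIntegral.integral_mono_on (by linarith)
      (intervalIntegrable_pow_mul_exp_neg j _ _) intervalIntegrable_const fun t ht => ?_
    have h := pow_mul_exp_neg_le hnR (s := n - t) (by linarith [ht.1]) j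
    rw [sub_sub_cancel] at h
    refine h.trans (mul_le_mul_of_nonneg_left ?_ (by positivity))
    refine le_trans (Real.exp_le_exp.2 ?_) (exp_mul_le_one_add (hl.trans hlC) hy0 hy1)
    exact mul_le_mul_of_nonneg_right (by linarith [ht.1]) hy0
  rw [intervalIntegral.integral_const, sub_sub_cancel, smul_eq_mul] at hint
  unfold endpointMass endpointDensity
  rw [div_le_iff₀ hG]
  refine hint.trans_eq ?_
  field_simp

lemma le_endpointMass {n j : ℕ} (hn : 0 < n) (hj : j ≤ n) {l C : ℝ} (hl : 0 ≤ l) (hlC : l ≤ C)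
    (hln : l ≤ n) :
    l * endpointDensity n j * (1 - C ^ 2 / n) ≤ endpointMass n l j := by
  have hnR : (0 : ℝ) < n := by exact_mod_cast hn
  have hG := powExpIntegral_pos hnR j
  have hint : ∫ _ in (n - l)..(n : ℝ), (n : ℝ) ^ j * Real.exp (-n) * (1 - C ^ 2 / n) ≤
      ∫ t in (n - l)..(n : ℝ), t ^ j * Real.exp (-t) := by
    refine intervalIntegral.integral_mono_on (by linarith) intervalIntegrable_const
      (intervalIntegrable_pow_mul_exp_neg j _ _) fun t ht => ?_
    have h := le_pow_mul_exp_neg hn hj (s := n - t) (by linarith [ht.2]) (by linarith [ht.1])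
    rw [sub_sub_cancel] at h
    refine le_trans (mul_le_mul_of_nonneg_left ?_ (by positivity)) h
    have h0 : 0 ≤ n - t := by linarith [ht.2]
    have h1 : n - t ≤ C := by linarith [ht.1]
    gcongr
  rw [intervalIntegral.integral_const, sub_sub_cancel, smul_eq_mul] at hint
  unfold endpointMass endpointDensity
  rw [le_div_iff₀ hG]
  refine le_of_eq_of_le ?_ hint
  field_simp

lemma abs_sum_endpointMass_sub_le {n : ℕ} (hn : 0 < n) {l C : ℝ} (hl : 0 ≤ l) (hlC : l ≤ C)
    (hln : l ≤ n) :
    |∑ j ∈ range n, endpointMass n l j - l * ∑ j ∈ range n, endpointDensity n j| ≤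
      C * (C ^ 2 / n * ∑ j ∈ range n, endpointDensity n j +
        C * Real.exp C * endpointDensity n n) := by
  have hnR : (0 : ℝ) < n := by exact_mod_cast hn
  have hC : 0 ≤ C := hl.trans hlC
  have hA : 0 ≤ ∑ j ∈ range n, endpointDensity n j :=
    sum_nonneg fun j _ => (endpointDensity_pos hnR j).le
  have hd := (endpointDensity_pos hnR n).le
  have hweighted : ∑ j ∈ range n, (1 - (j : ℝ) / n) * endpointDensity n j ≤
      endpointDensity n n := by
    have h := sum_one_sub_div_mul_endpointDensity_le hnR n
    rw [sum_range_succ, div_self hnR.ne'] at h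
    linarith
  have hup : ∑ j ∈ range n, endpointMass n l j ≤ l * ∑ j ∈ range n, endpointDensity n j +
      l * (C * Real.exp C) * ∑ j ∈ range n, (1 - (j : ℝ) / n) * endpointDensity n j := by
    rw [mul_sum, mul_sum, ← sum_add_distrib]
    refine sum_le_sum fun j hj => ?_
    refine (endpointMass_le hn (mem_range.1 hj).le hl hlC hln).trans_eq ?_
    ring
  have hlow : l * (∑ j ∈ range n, endpointDensity n j) * (1 - C ^ 2 / n) ≤
      ∑ j ∈ range n, endpointMass n l j := by
    rw [mul_sum, sum_mul]
    exact sum_le_sum fun j hj => le_endpointMass hn (mem_range.1 hj).le hl hlC hln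
  have h1 : l * (C ^ 2 / n * ∑ j ∈ range n, endpointDensity n j) ≤
      C * (C ^ 2 / n * ∑ j ∈ range n, endpointDensity n j) := by gcongr
  have h2 : l * (C * Real.exp C) * ∑ j ∈ range n, (1 - (j : ℝ) / n) * endpointDensity n j ≤
      C * (C * Real.exp C * endpointDensity n n) := by
    calc _ ≤ l * (C * Real.exp C) * endpointDensity n n :=
          mul_le_mul_of_nonneg_left hweighted (by positivity)
      _ = l * (C * Real.exp C * endpointDensity n n) := by ring
      _ ≤ _ := by gcongr
  have h3 : 0 ≤ C * (C ^ 2 / n * ∑ j ∈ range n, endpointDensity n j) := by positivity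
  have h4 : 0 ≤ C * (C * Real.exp C * endpointDensity n n) := by positivity
  rw [abs_le]
  constructor <;> linarith

lemma prod_one_sub_le_exp_neg_sum_s1 {n : ℕ} {b : ℕ → ℝ} (hb : ∀ j < n, b j ≤ 1) :
    ∏ j ∈ range n, (1 - b j) ≤ Real.exp (-∑ j ∈ range n, b j) := by
  rw [← sum_neg_distrib, Real.exp_sum]
  exact prod_le_prod (fun j hj => by linarith [hb j (mem_range.1 hj)])
    fun j _ => Real.one_sub_le_exp_neg _

lemma exp_neg_sum_div_le_prod_one_sub {n : ℕ} {b : ℕ → ℝ} {m : ℝ} (hm : m < 1)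
    (hb0 : ∀ j < n, 0 ≤ b j) (hb : ∀ j < n, b j ≤ m) :
    Real.exp (-((∑ j ∈ range n, b j) / (1 - m))) ≤ ∏ j ∈ range n, (1 - b j) := by
  rw [sum_div, ← sum_neg_distrib, Real.exp_sum]
  refine prod_le_prod (fun j _ => (Real.exp_pos _).le) fun j hj => ?_
  have h0 := hb0 j (mem_range.1 hj)
  have h1 := hb j (mem_range.1 hj)
  have hpos : 0 < 1 - b j := by linarith
  have h2 : b j / (1 - b j) ≤ b j / (1 - m) :=
    div_le_div_of_nonneg_left h0 (by linarith) (by linarith)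
  have h3 : (1 - b j)⁻¹ ≤ Real.exp (b j / (1 - m)) := by
    calc (1 - b j)⁻¹ = b j / (1 - b j) + 1 := by field_simp; ring
      _ ≤ b j / (1 - m) + 1 := by linarith
      _ ≤ _ := Real.add_one_le_exp _
  rw [Real.exp_neg]
  exact inv_le_of_inv_le₀ hpos h3

lemma abs_exp_sub_exp_le_of_nonpos {x y : ℝ} (hx : x ≤ 0) (hy : y ≤ 0) :
    |Real.exp x - Real.exp y| ≤ |x - y| := by
  wlog h : y ≤ x generalizing x y
  · rw [abs_sub_comm, abs_sub_comm x]
    exact this hy hx (le_of_not_ge h)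
  rw [abs_of_nonneg (sub_nonneg.2 (Real.exp_le_exp.2 h)), abs_of_nonneg (sub_nonneg.2 h)]
  have h1 := Real.one_sub_le_exp_neg (x - y)
  have h2 : Real.exp y = Real.exp x * Real.exp (-(x - y)) := by
    rw [← Real.exp_add]
    congr 1
    ring
  have h3 : Real.exp x ≤ 1 := Real.exp_le_one_iff.2 hx
  have h4 : Real.exp x * (1 - (x - y)) ≤ Real.exp y :=
    h2 ▸ mul_le_mul_of_nonneg_left h1 (Real.exp_pos _).le
  have h5 : Real.exp x * (x - y) ≤ x - y := mul_le_of_le_one_left (by linarith) h3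
  linarith

lemma abs_prod_one_sub_sub_exp_le {n : ℕ} {b : ℕ → ℝ} {m ξ : ℝ} (hξ : ξ ≤ 0) (hm0 : 0 ≤ m)
    (hm : m ≤ 1 / 2) (hb0 : ∀ j < n, 0 ≤ b j) (hb : ∀ j < n, b j ≤ m) :
    |∏ j ∈ range n, (1 - b j) - Real.exp ξ| ≤
      |∑ j ∈ range n, b j + ξ| + 2 * m * ∑ j ∈ range n, b j := by
  set S := ∑ j ∈ range n, b j with hS
  have hS0 : 0 ≤ S := sum_nonneg fun j hj => hb0 j (mem_range.1 hj)
  have hup := prod_one_sub_le_exp_neg_sum_s1 fun j hj => (hb j hj).trans (by linarith : m ≤ 1)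
  have hlow := exp_neg_sum_div_le_prod_one_sub (by linarith) hb0 hb
  rw [← hS] at hup hlow
  have hdiv : S / (1 - m) ≤ S + 2 * m * S := by
    rw [div_le_iff₀ (by linarith)]
    nlinarith [mul_nonneg (mul_nonneg hm0 hS0) (by linarith : 0 ≤ 1 - 2 * m)]
  have hlow' : Real.exp (-(S + 2 * m * S)) ≤ ∏ j ∈ range n, (1 - b j) :=
    (Real.exp_le_exp.2 (by linarith)).trans hlow
  have hmS : 0 ≤ 2 * m * S := by positivity
  have e1 := (abs_le.1 (abs_exp_sub_exp_le_of_nonpos (x := -S) (by linarith) hξ)).2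
  have e2 := (abs_le.1 (abs_exp_sub_exp_le_of_nonpos
    (x := -(S + 2 * m * S)) (by linarith) hξ)).1
  have a1 : |-S - ξ| = |S + ξ| := by rw [← abs_neg]; congr 1; ring
  have a2 : |-(S + 2 * m * S) - ξ| ≤ |S + ξ| + 2 * m * S := by
    rw [← abs_neg, show -(-(S + 2 * m * S) - ξ) = (S + ξ) + 2 * m * S by ring]
    exact (abs_add_le _ _).trans_eq (by rw [abs_of_nonneg hmS])
  rw [abs_le]
  constructor <;> linarith

lemma abs_prod_one_sub_endpointMass_sub_exp_le {n : ℕ} {M ξ : ℝ} (hn : 0 < n) (hξ0 : ξ ≤ 0)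
    (hξM : -M ≤ ξ) (hMn : M ≤ 2 * n * Real.log 4) {C : ℝ} (hC : C = 2 * M / Real.log 4)
    {m : ℝ} (hm : m = C * endpointDensity n n * (1 + C * Real.exp C)) (hm2 : m ≤ 1 / 2)
    {A : ℝ} (hA : A = ∑ j ∈ range n, endpointDensity n j)
    {E : ℝ} (hE : E = C * (C ^ 2 / n * A + C * Real.exp C * endpointDensity n n)) :
    |∏ j ∈ range n, (1 - endpointMass n (n - n * (1 + ξ / (n * Real.log 4)) ^ 2) j) -
        Real.exp ξ| ≤
      E + C * |A - Real.log 2| + M ^ 2 / (n * Real.log 4 ^ 2) * Real.log 2 +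
        2 * m * (C * A + E) := by
  have hnR : (0 : ℝ) < n := by exact_mod_cast hn
  have hL : 0 < Real.log 4 := Real.log_pos (by norm_num)
  have hlog2 : 0 < Real.log 2 := Real.log_pos (by norm_num)
  have hL2 : Real.log 4 = 2 * Real.log 2 := by
    rw [show (4 : ℝ) = 2 ^ 2 by norm_num, Real.log_pow]
    norm_num
  have hM : 0 ≤ M := by linarith
  have hC0 : 0 ≤ C := by rw [hC]; positivity
  have hd : 0 < endpointDensity n n := endpointDensity_pos hnR n
  have hm0 : 0 ≤ m := by rw [hm]; positivity
  have hA0 : 0 ≤ A := by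
    rw [hA]
    exact sum_nonneg fun j _ => (endpointDensity_pos hnR j).le
  obtain ⟨l, hl⟩ : ∃ l, l = n - n * (1 + ξ / (n * Real.log 4)) ^ 2 := ⟨_, rfl⟩
  rw [← hl]
  have hl_expand : l = -(2 * ξ / Real.log 4) - ξ ^ 2 / (n * Real.log 4 ^ 2) := by
    rw [hl]
    field_simp
    ring
  have hsq0 : 0 ≤ ξ ^ 2 / (n * Real.log 4 ^ 2) := by positivity
  have hsqM : ξ ^ 2 / (n * Real.log 4 ^ 2) ≤ M ^ 2 / (n * Real.log 4 ^ 2) := by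
    have : ξ ^ 2 ≤ M ^ 2 := sq_le_sq' hξM (by linarith)
    gcongr
  have hl0 : 0 ≤ l := by
    have h : l = -ξ * (2 * n * Real.log 4 + ξ) / (n * Real.log 4 ^ 2) := by
      rw [hl_expand]
      field_simp
      ring
    rw [h]
    exact div_nonneg (mul_nonneg (by linarith) (by linarith)) (by positivity)
  have hlC : l ≤ C := by
    have h : -(2 * ξ / Real.log 4) ≤ C := by
      rw [hC, ← neg_div]
      exact div_le_div_of_nonneg_right (by linarith) hL.le
    linarith
  have hln : l ≤ n := by
    have : 0 ≤ n * (1 + ξ / (n * Real.log 4)) ^ 2 := by positivity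
    linarith
  have hb0 : ∀ j < n, 0 ≤ endpointMass n l j := fun j _ => endpointMass_nonneg hnR hl0 hln j
  have hb : ∀ j < n, endpointMass n l j ≤ m := by
    intro j hj
    refine (endpointMass_le hn hj.le hl0 hlC hln).trans ?_
    have h1 : endpointDensity n j ≤ endpointDensity n n := endpointDensity_mono hnR hj.le
    have h2 : 0 ≤ 1 - (j : ℝ) / n := by
      rw [sub_nonneg, div_le_one hnR]
      exact_mod_cast hj.le
    have h3 : 1 - (j : ℝ) / n ≤ 1 := by
      have : 0 ≤ (j : ℝ) / n := by positivity
      linarith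
    have h4 := (endpointDensity_pos hnR j).le
    rw [hm]
    have h5 : C * Real.exp C * (1 - (j : ℝ) / n) ≤ C * Real.exp C :=
      mul_le_of_le_one_right (by positivity) h3
    gcongr
  have hS := abs_sum_endpointMass_sub_le hn hl0 hlC hln
  rw [← hA, ← hE] at hS
  refine (abs_prod_one_sub_sub_exp_le hξ0 hm0 hm2 hb0 hb).trans ?_
  obtain ⟨S, hSdef⟩ : ∃ S, S = ∑ j ∈ range n, endpointMass n l j := ⟨_, rfl⟩
  rw [← hSdef] at hS ⊢
  have hSle : S ≤ C * A + E := by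
    have h1 := (abs_le.1 hS).2
    have h2 : l * A ≤ C * A := mul_le_mul_of_nonneg_right hlC hA0
    linarith
  have hdecomp : S + ξ = (S - l * A) + l * (A - Real.log 2) -
      ξ ^ 2 / (n * Real.log 4 ^ 2) * Real.log 2 := by
    rw [eq_sub_iff_add_eq]
    have h : ξ = (2 * ξ / Real.log 4) * Real.log 2 := by
      rw [hL2]
      field_simp
    have h' : l * Real.log 2 = -ξ - ξ ^ 2 / (n * Real.log 4 ^ 2) * Real.log 2 := by
      rw [hl_expand, sub_mul, neg_mul, ← h]
    linarith
  have hSξ : |S + ξ| ≤ E + C * |A - Real.log 2| + M ^ 2 / (n * Real.log 4 ^ 2) * Real.log 2 := by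
    rw [hdecomp]
    refine (abs_sub _ _).trans (add_le_add ((abs_add_le _ _).trans (add_le_add hS ?_)) ?_)
    · rw [abs_mul, abs_of_nonneg hl0]
      exact mul_le_mul_of_nonneg_right hlC (abs_nonneg _)
    · rw [abs_of_nonneg (by positivity)]
      exact mul_le_mul_of_nonneg_right hsqM hlog2.le
  have := mul_le_mul_of_nonneg_left hSle (by positivity : 0 ≤ 2 * m)
  linarith

/-- Hard edge Ginibre case: with `x_n = 1 + ξ/(n log 4)`,
`∏_{j=0}^{n−1} (1 − (∫_{n x_n²}^{n} t^j e^{−t} dt) / γ(j+1, n)) → e^ξ`,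
uniformly for `ξ` in compact subsets of `(−∞, 0]`. -/
theorem hard_edge_ginibre_spectral_radius
    (K : Set ℝ) (hK : IsCompact K) (hK' : K ⊆ Set.Iic 0) :
    TendstoUniformlyOn
      (fun (n : ℕ) (ξ : ℝ) =>
        ∏ j ∈ Finset.range n,
          (1 - (∫ t in ((n : ℝ) * (1 + ξ / (n * Real.log 4)) ^ 2)..(n : ℝ),
                  t ^ j * Real.exp (-t)) / lowerGamma ((j : ℝ) + 1) n))
      (fun ξ => Real.exp ξ) atTop K := by
  obtain ⟨R, hR⟩ := hK.isBounded.subset_closedBall 0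
  obtain ⟨M, hM⟩ : ∃ M : ℝ, ∀ ξ ∈ K, -M ≤ ξ := ⟨R, fun ξ hξ => by
    have := hR hξ
    rw [mem_closedBall_zero_iff, Real.norm_eq_abs] at this
    exact (abs_le.1 this).1⟩
  have hL : 0 < Real.log 4 := Real.log_pos (by norm_num)
  obtain ⟨C, hC⟩ : ∃ C, C = 2 * M / Real.log 4 := ⟨_, rfl⟩
  have hcast : Tendsto (fun n : ℕ => (n : ℝ)) atTop atTop := tendsto_natCast_atTop_atTop
  have hm : Tendsto (fun n : ℕ => C * endpointDensity n n * (1 + C * Real.exp C)) atTop (𝓝 0) := by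
    simpa using (tendsto_endpointDensity_self.const_mul C).mul_const (1 + C * Real.exp C)
  have hE : Tendsto (fun n : ℕ => C * (C ^ 2 / n * ∑ j ∈ range n, endpointDensity n j +
      C * Real.exp C * endpointDensity n n)) atTop (𝓝 0) := by
    simpa using (((hcast.const_div_atTop (C ^ 2)).mul tendsto_sum_endpointDensity).add
      (tendsto_endpointDensity_self.const_mul (C * Real.exp C))).const_mul C
  have hA : Tendsto (fun n : ℕ => C * |∑ j ∈ range n, endpointDensity n j - Real.log 2|) atTop
      (𝓝 0) := by
    simpa using ((tendsto_sum_endpointDensity.sub_const (Real.log 2)).abs).const_mul C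
  have hsq : Tendsto (fun n : ℕ => M ^ 2 / (n * Real.log 4 ^ 2) * Real.log 2) atTop (𝓝 0) := by
    simpa using ((hcast.atTop_mul_const (pow_pos hL 2)).const_div_atTop (M ^ 2)).mul_const
      (Real.log 2)
  have hbound := ((hE.add hA).add hsq).add
    ((hm.const_mul 2).mul ((tendsto_sum_endpointDensity.const_mul C).add hE))
  simp only [mul_zero, add_zero, zero_mul] at hbound
  rw [Metric.tendstoUniformlyOn_iff]
  intro ε hε
  filter_upwards [hbound.eventually (gt_mem_nhds hε), eventually_gt_atTop 0,
    hm.eventually (ge_mem_nhds (by norm_num : (0 : ℝ) < 1 / 2)),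
    ((hcast.const_mul_atTop two_pos).atTop_mul_const hL).eventually_ge_atTop M]
    with n hnε hn hnm hnM ξ hξ
  rw [dist_comm, Real.dist_eq]
  refine lt_of_le_of_lt ?_ hnε
  simpa only [lowerGamma_natCast_add_one, endpointMass, sub_sub_cancel] using
    abs_prod_one_sub_endpointMass_sub_exp_le hn (hK' hξ) (hM ξ hξ) hnM hC rfl hnm rfl rfl
end
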